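/- Let 1 ≤ k ≤ n and 1 ≤ l ≤ m. If there exists an S³-equivariant continuous map f : ℍV_{n,k} → ℍV_{m,l} (equivariant with respect to the actions of the group of unit quaternions by entrywise left scalar multiplication), then n − k ≤ m − l. -/

import Mathlib

open scoped Quaternion
open Matrix

/-- The quaternionic Stiefel manifold `ℍV_{n,k}` of orthonormal `k`-frames in `ℍⁿ`,
realized as the space of `k × n` quaternionic matrices `A` with `A * Aᴴ = 1`, with the
subspace topology from the space of matrices. -/
abbrev QStiefel (n k : ℕ) : Type :=
  {A : Matrix (Fin k) (Fin n) ℍ[ℝ] // A * Aᴴ = 1}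

section

open MeasureTheory Set Filter Topology Module
open scoped ContDiff

theorem integral_fderiv_apply_eq_zero {E : Type*} [NormedAddCommGroup E] [NormedSpace ℝ E]
    [FiniteDimensional ℝ E] [MeasurableSpace E] [BorelSpace E] (μ : Measure E)
    [μ.IsAddHaarMeasure] {h : E → ℝ} (hc : ContDiff ℝ 1 h) (hs : HasCompactSupport h) (v : E) :
    ∫ x, fderiv ℝ h x v ∂μ = 0 := by
  have h1 : Continuous fun x => fderiv ℝ h x v := (hc.continuous_fderiv one_ne_zero).clm_apply
    continuous_const
  have h2 : HasCompactSupport fun x => fderiv ℝ h x v := hs.fderiv_apply ℝ v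
  have := integral_mul_fderiv_eq_neg_fderiv_mul_of_integrable (μ := μ) (f := fun _ : E => (1 : ℝ))
    (g := h) (v := v) (by simp) (by simpa using h1.integrable_of_hasCompactSupport h2)
    (by simpa using hc.continuous.integrable_of_hasCompactSupport hs) (by simp)
    (fun x _ => hc.differentiable one_ne_zero x)
  simpa using this

theorem hasCompactSupport_slice {E : Type*} [NormedAddCommGroup E] [NormedSpace ℝ E]
    [FiniteDimensional ℝ E] {h : E → ℝ} {R : ℝ} (hs : ∀ y, R < ‖y‖ → h y = 0) :
    HasCompactSupport h := by
  refine HasCompactSupport.intro (isCompact_closedBall (0 : E) R) fun x hx => hs x ?_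
  simpa using hx

theorem integral_slice_eq {E : Type*} [NormedAddCommGroup E] [NormedSpace ℝ E]
    [FiniteDimensional ℝ E] [MeasurableSpace E] [BorelSpace E] (μ : Measure E)
    [μ.IsAddHaarMeasure] {N : ℕ} {g : ℝ × E → ℝ} {h : Fin N → ℝ × E → ℝ} {R : ℝ}
    (hg : ContDiff ℝ 1 g) (hh : ∀ i, ContDiff ℝ 1 (h i))
    (hgs : ∀ t y, R < ‖y‖ → g (t, y) = 0) (hhs : ∀ i t y, R < ‖y‖ → h i (t, y) = 0)
    (c : Fin N → ℝ) (e : Fin N → E)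
    (hd : ∀ t y, fderiv ℝ g (t, y) (1, 0) = ∑ i, c i * fderiv ℝ (h i) (t, y) (0, e i))
    (s t : ℝ) :
    ∫ y, g (s, y) ∂μ = ∫ y, g (t, y) ∂μ := by
  have hslice : ∀ (f : ℝ × E → ℝ), ContDiff ℝ 1 f → ∀ t, ContDiff ℝ 1 fun y => f (t, y) := by
    intro f hf t
    exact hf.comp (contDiff_const.prodMk contDiff_id)
  have key : ∀ t, HasDerivAt (fun t => ∫ y, g (t, y) ∂μ) 0 t := by
    intro t
    have hz : ∫ y, fderiv ℝ g (t, y) (1, 0) ∂μ = 0 := by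
      simp_rw [hd]
      have hfd : ∀ i y, fderiv ℝ (h i) (t, y) (0, e i) = fderiv ℝ (fun y => h i (t, y)) y (e i) := by
        intro i y
        have h1 : HasFDerivAt (fun y : E => (t, y)) (ContinuousLinearMap.inr ℝ ℝ E) y :=
          hasFDerivAt_prodMk_right t y
        have := (((hh i).differentiable one_ne_zero (t, y)).hasFDerivAt.comp y h1).fderiv
        have h3 : (fun y => h i (t, y)) = h i ∘ fun y => (t, y) := rfl
        rw [h3, this]; simp
      have hcs : ∀ i, HasCompactSupport fun y => h i (t, y) := fun i =>
        hasCompactSupport_slice (R := R) (hhs i t)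
      rw [integral_finsetSum]
      · refine Finset.sum_eq_zero fun i _ => ?_
        rw [integral_const_mul]
        simp_rw [hfd]
        rw [integral_fderiv_apply_eq_zero μ (hslice _ (hh i) t) (hcs i), mul_zero]
      · intro i _
        refine Integrable.const_mul ?_ _
        simp_rw [hfd]
        exact (((hslice _ (hh i) t).continuous_fderiv one_ne_zero).clm_apply
          continuous_const).integrable_of_hasCompactSupport ((hcs i).fderiv_apply ℝ _)
    have hcont : Continuous fun p => fderiv ℝ g p (1, 0) :=
      (hg.continuous_fderiv one_ne_zero).clm_apply continuous_const
    obtain ⟨C, hC⟩ := ((isCompact_closedBall t 1).prod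
      (isCompact_closedBall (0 : E) R)).exists_bound_of_continuousOn hcont.continuousOn
    have hder : ∀ x y, HasDerivAt (fun t => g (t, y)) (fderiv ℝ g (x, y) (1, 0)) x := by
      intro x y
      have h1 : HasDerivAt (fun x : ℝ => (x, y)) ((1 : ℝ), (0 : E)) x :=
        (hasDerivAt_id x).prodMk (hasDerivAt_const x y)
      exact (hg.differentiable one_ne_zero (x, y)).hasFDerivAt.comp_hasDerivAt x h1
    have := (hasDerivAt_integral_of_dominated_loc_of_deriv_le (μ := μ) (F := fun t y => g (t, y))
      (F' := fun t y => fderiv ℝ g (t, y) (1, 0)) (x₀ := t)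
      (bound := (Metric.closedBall (0 : E) R).indicator fun _ => C)
      (Metric.closedBall_mem_nhds t one_pos)
      (Eventually.of_forall fun x => (hslice g hg x).continuous.aestronglyMeasurable)
      ((hslice g hg t).continuous.integrable_of_hasCompactSupport
        (hasCompactSupport_slice (R := R) (hgs t)))
      (hcont.comp (by fun_prop : Continuous fun y : E => (t, y))).aestronglyMeasurable
      (Eventually.of_forall fun y x hx => ?_) ?_
      (Eventually.of_forall fun y x _ => hder x y)).2
    · rwa [hz] at this
    · by_cases hy : y ∈ Metric.closedBall (0 : E) R
      · rw [indicator_of_mem hy]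
        exact hC (x, y) ⟨hx, hy⟩
      · rw [indicator_of_notMem hy]
        have h0 : (fun t => g (t, y)) = fun _ => 0 := by
          funext t; exact hgs t y (by simpa using hy)
        have := hder x y
        rw [h0] at this
        rw [this.unique (hasDerivAt_const x (0 : ℝ)), norm_zero]
    · exact (integrableOn_const (isCompact_closedBall (0 : E) R).measure_lt_top.ne).integrable_indicator
        measurableSet_closedBall
  exact is_const_of_deriv_eq_zero (fun t => (key t).differentiableAt) (fun t => (key t).deriv) s t

/-- The determinant form of a basis, as a continuous alternating map. -/
noncomputable def continuousDet {E : Type*} [NormedAddCommGroup E] [NormedSpace ℝ E]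
    [FiniteDimensional ℝ E] {N : ℕ} (b : Basis (Fin N) ℝ E) : E [⋀^Fin N]→L[ℝ] ℝ :=
  { b.det with
    cont := by
      change Continuous fun v => b.det v
      simp_rw [Basis.det_apply]
      refine Continuous.matrix_det (continuous_matrix fun i j => ?_)
      exact (LinearMap.continuous_of_finiteDimensional (b.coord i)).comp (continuous_apply j) }

theorem continuousDet_apply {E : Type*} [NormedAddCommGroup E] [NormedSpace ℝ E]
    [FiniteDimensional ℝ E] {N : ℕ} (b : Basis (Fin N) ℝ E) (v : Fin N → E) :
    continuousDet b v = b.det v := rfl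

theorem extDeriv_pullback_top {E : Type*} [NormedAddCommGroup E] [NormedSpace ℝ E]
    [FiniteDimensional ℝ E] {N : ℕ} (b : Basis (Fin N) ℝ E) {φ : E → ℝ} (hφ : ContDiff ℝ 2 φ)
    {H : ℝ × E → E} (hH : ContDiff ℝ 2 H) (x : ℝ × E) (v : Fin (N + 1) → ℝ × E) :
    ∑ i : Fin (N + 1), (-1) ^ i.val * fderiv ℝ (fun x => φ (H x) *
      b.det (fun j => fderiv ℝ H x (i.removeNth v j))) x (v i) = 0 := by
  have hω : Differentiable ℝ fun z => φ z • continuousDet b :=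
    (hφ.differentiable two_ne_zero).smul_const _
  have h1 := extDeriv_pullback (x := x) (hω (H x)) hH.contDiffAt (by simp)
  have h2 : extDeriv (fun z => φ z • continuousDet b) (H x) = 0 := by
    ext w
    have hdep : ¬ LinearIndependent ℝ w := fun hw => by
      have := hw.fintype_card_le_finrank
      rw [finrank_eq_card_basis b] at this
      simp at this
    exact (extDeriv (fun z => φ z • continuousDet b) (H x)).toAlternatingMap.map_linearDependent
      w hdep
  have hdiff : DifferentiableAt ℝ (fun x => (φ (H x) • continuousDet b).compContinuousLinearMap
      (fderiv ℝ H x)) x := by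
    refine DifferentiableAt.continuousAlternatingMapCompContinuousLinearMap ?_ ?_
    · exact (hω (H x)).comp x (hH.differentiable two_ne_zero x)
    · exact (hH.fderiv_right (m := 1) (by norm_num)).differentiable one_ne_zero x
  have h3 := extDeriv_apply hdiff v
  rw [h1, h2] at h3
  simpa [continuousDet_apply, Function.comp_def] using h3.symm

theorem contDiff_mul_det_fderiv {E : Type*} [NormedAddCommGroup E] [NormedSpace ℝ E]
    [FiniteDimensional ℝ E] {N : ℕ} (b : Basis (Fin N) ℝ E) {φ : E → ℝ} (hφ : ContDiff ℝ 2 φ)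
    {H : ℝ × E → E} (hH : ContDiff ℝ 2 H) (w : Fin N → ℝ × E) :
    ContDiff ℝ 1 fun x => φ (H x) * b.det (fun j => fderiv ℝ H x (w j)) := by
  refine ((hφ.comp hH).of_le (by norm_num)).mul ?_
  have h1 : ContDiff ℝ 1 fun x => (fun j => fderiv ℝ H x (w j)) := contDiff_pi.2 fun j =>
    (hH.fderiv_right (m := 1) (by norm_num)).clm_apply contDiff_const
  exact (continuousDet b).toContinuousMultilinearMap.contDiff.comp h1

/-- A homotopy between self-maps of a vector space with uniformly bounded zero sets preserves
the degree over the origin. -/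
theorem not_homotopic_of_det_pos {E : Type*} [NormedAddCommGroup E] [NormedSpace ℝ E]
    [FiniteDimensional ℝ E] {H : ℝ × E → E} (hH : ContDiff ℝ 2 H) {δ R : ℝ} (hδ : 0 < δ)
    (hR : ∀ t ∈ Icc (0 : ℝ) 1, ∀ y, ‖H (t, y)‖ < δ → ‖y‖ ≤ R)
    (h0 : ∀ y, H (0, y) ≠ 0) (h1 : ∃ y, H (1, y) = 0)
    (hdet : ∀ y, H (1, y) = 0 → 0 < (fderiv ℝ (fun y => H (1, y)) y).det) : False := by
  borelize E
  obtain ⟨y₁, hy₁⟩ := h1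
  set b := finBasis ℝ E
  have hC : ∀ t, ContDiff ℝ 2 fun y => H (t, y) := fun t =>
    hH.comp (contDiff_const.prodMk contDiff_id)
  have hdc : Continuous fun y => (fderiv ℝ (fun y => H (1, y)) y).det :=
    ContinuousLinearMap.continuous_det.comp ((hC 1).continuous_fderiv two_ne_zero)
  -- a uniform radius
  obtain ⟨r, hr, hrδ, hr0, hr1⟩ : ∃ r > 0, r ≤ δ ∧ (∀ y, r ≤ ‖H (0, y)‖) ∧
      ∀ y, ‖H (1, y)‖ < r → 0 < (fderiv ℝ (fun y => H (1, y)) y).det := by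
    have aux : ∀ (t : ℝ) (K : Set E), IsCompact K → (∀ y ∈ K, H (t, y) ≠ 0) →
        ∃ r > 0, ∀ y ∈ K, r ≤ ‖H (t, y)‖ := by
      intro t K hK hne
      obtain ⟨r, hr, h⟩ := hK.exists_forall_le' (f := fun y => ‖H (t, y)‖) (a := 0)
        (hC t).continuous.norm.continuousOn (fun y hy => norm_pos_iff.2 (hne y hy))
      exact ⟨r, hr, h⟩
    obtain ⟨r₀, hr₀, h₀⟩ := aux 0 (Metric.closedBall 0 R) (isCompact_closedBall _ _)
      fun y _ => h0 y
    obtain ⟨r₁, hr₁, h₁⟩ := aux 1 (Metric.closedBall 0 R ∩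
      {y | (fderiv ℝ (fun y => H (1, y)) y).det ≤ 0})
      ((isCompact_closedBall _ _).inter_right (isClosed_le hdc continuous_const))
      fun y hy h => (hdet y h).not_ge hy.2
    refine ⟨min δ (min r₀ r₁), by positivity, min_le_left _ _, fun y => ?_, fun y hy => ?_⟩
    · by_contra! hlt
      have hy := hR 0 (by simp) y (hlt.trans_le (min_le_left _ _))
      exact (hlt.trans_le ((min_le_right _ _).trans (min_le_left _ _))).not_ge
        (h₀ y (by simpa using hy))
    · by_contra! hle
      have hyR := hR 1 (by simp) y (hy.trans_le (min_le_left _ _))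
      exact (hy.trans_le ((min_le_right _ _).trans (min_le_right _ _))).not_ge
        (h₁ y ⟨by simpa using hyR, hle⟩)
  let φ : ContDiffBump (0 : E) := ⟨r / 2, r, half_pos hr, half_lt_self hr⟩
  have hφ0 : ∀ z : E, r ≤ ‖z‖ → φ z = 0 := fun z hz => φ.zero_of_le_dist (by simpa using hz)
  have hφ : ContDiff ℝ 2 φ := φ.contDiff
  let K : ℝ × E → E := fun p => H (Real.smoothTransition p.1, p.2)
  have hK : ContDiff ℝ 2 K :=
    hH.comp ((Real.smoothTransition.contDiff.comp contDiff_fst).prodMk contDiff_snd)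
  have hKR : ∀ t y, R < ‖y‖ → φ (K (t, y)) = 0 := fun t y hy => hφ0 _ <| by
    by_contra! hlt
    exact hy.not_ge (hR _ ⟨Real.smoothTransition.nonneg _, Real.smoothTransition.le_one _⟩ y
      (hlt.trans_le hrδ))
  have hKd : ∀ t y w, fderiv ℝ K (t, y) (0, w) =
      fderiv ℝ (fun y => H (Real.smoothTransition t, y)) y w := by
    intro t y w
    have h1 : HasFDerivAt (fun y : E => (t, y)) (ContinuousLinearMap.inr ℝ ℝ E) y :=
      hasFDerivAt_prodMk_right t y
    have := ((hK.differentiable two_ne_zero (t, y)).hasFDerivAt.comp y h1).fderiv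
    have h3 : (fun y => H (Real.smoothTransition t, y)) = K ∘ fun y => (t, y) := rfl
    rw [h3, this]; simp
  let v : Fin (finrank ℝ E + 1) → ℝ × E := Fin.cons (1, 0) fun i => (0, b i)
  let h : Fin (finrank ℝ E + 1) → ℝ × E → ℝ := fun i x => φ (K x) *
      b.det (fun j => fderiv ℝ K x (i.removeNth v j))
  have hh : ∀ i, ContDiff ℝ 1 (h i) := fun i => contDiff_mul_det_fderiv b hφ hK _
  have hhs : ∀ i t y, R < ‖y‖ → h i (t, y) = 0 := fun i t y hy => by
    simp only [h, hKR t y hy, zero_mul]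
  have hd : ∀ t y, fderiv ℝ (h 0) (t, y) (1, 0) =
      ∑ i : Fin (finrank ℝ E), (-(-1) ^ (i.val + 1)) * fderiv ℝ (h i.succ) (t, y) (0, b i) := by
    intro t y
    have := extDeriv_pullback_top b hφ hK (t, y) v
    rw [Fin.sum_univ_succ] at this
    simp only [Fin.val_zero, pow_zero, one_mul, Fin.val_succ] at this
    simp only [neg_mul, Finset.sum_neg_distrib]
    exact eq_neg_of_add_eq_zero_left this
  have hh0 : ∀ t y, h 0 (t, y) = φ (H (Real.smoothTransition t, y)) *
      (fderiv ℝ (fun y => H (Real.smoothTransition t, y)) y).det := by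
    intro t y
    simp only [h, K]
    congr 1
    have : (fun j => fderiv ℝ K (t, y) ((0 : Fin (finrank ℝ E + 1)).removeNth v j)) =
        (fderiv ℝ (fun y => H (Real.smoothTransition t, y)) y : E →ₗ[ℝ] E) ∘ b := by
      funext j
      exact hKd t y (b j)
    erw [this, b.det_comp, b.det_self, mul_one]
  have heq := integral_slice_eq (μ := Measure.addHaar) (hh 0) (fun i => hh i.succ) (hhs 0)
    (fun i => hhs i.succ) _ _ hd 0 1
  simp only [hh0, Real.smoothTransition.zero, Real.smoothTransition.one] at heq
  have hz : ∀ y, φ (H (0, y)) = 0 := fun y => hφ0 _ (hr0 y)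
  simp only [hz, zero_mul, integral_zero] at heq
  have hpos := Continuous.integral_pos_of_hasCompactSupport_nonneg_nonzero
    (μ := (Measure.addHaar : Measure E))
    (f := fun y => φ (H (1, y)) * (fderiv ℝ (fun y => H (1, y)) y).det) (x := y₁)
    ((φ.continuous.comp (hC 1).continuous).mul hdc)
    (hasCompactSupport_slice (R := R) fun y hy => by
      have := hhs 0 1 y hy
      rwa [hh0, Real.smoothTransition.one] at this)
    (fun y => by
      by_cases hy : ‖H (1, y)‖ < r
      · exact mul_nonneg φ.nonneg (hr1 y hy).le
      · simp [hφ0 _ (not_lt.1 hy)])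
    (by
      have : φ (H (1, y₁)) = 1 := φ.one_of_mem_closedBall (by
        rw [hy₁]
        exact Metric.mem_closedBall_self (half_pos hr).le)
      simpa [this] using (hdet y₁ hy₁).ne')
  exact hpos.ne heq

theorem LinearMap.det_pos_of_complex {V : Type*} [AddCommGroup V] [Module ℝ V] [Module ℂ V]
    [IsScalarTower ℝ ℂ V] [FiniteDimensional ℂ V] (f : V →ₗ[ℂ] V) (hf : Function.Injective f) :
    0 < LinearMap.det (f.restrictScalars ℝ) := by
  rw [LinearMap.det_restrictScalars, Algebra.norm_complex_apply]
  have : LinearMap.det f ≠ 0 := by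
    have := (LinearMap.isUnit_iff_ker_eq_bot f).2 (LinearMap.ker_eq_bot.2 hf)
    exact ((LinearMap.isUnit_iff_isUnit_det f).1 this).ne_zero
  exact Complex.normSq_pos.2 this

/-- A real-linear injective endomorphism of `ℍⁿ` commuting with left multiplication by `i`
has positive determinant. -/
theorem det_pos_of_comm_imI {ι : Type*} [Fintype ι] (L : (ι → ℍ[ℝ]) →L[ℝ] (ι → ℍ[ℝ]))
    (hL : Function.Injective L)
    (hI : ∀ z c, L (fun i => (Complex.I : ℍ[ℝ]) * z i) c = (Complex.I : ℍ[ℝ]) * L z c) :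
    0 < L.det := by
  let _ : Module ℂ (ι → ℍ[ℝ]) := Module.compHom _ (Quaternion.ofComplex : ℂ →ₐ[ℝ] ℍ[ℝ]).toRingHom
  have hsmul : ∀ (z : ℂ) (w : ι → ℍ[ℝ]), z • w = fun i => (z : ℍ[ℝ]) * w i := fun z w => rfl
  have : IsScalarTower ℝ ℂ (ι → ℍ[ℝ]) := ⟨fun r z w => by
    funext i
    have : ((r • z : ℂ) : ℍ[ℝ]) = r • (z : ℍ[ℝ]) := by
      ext <;> simp
    simp only [hsmul, this, Pi.smul_apply, smul_mul_assoc]⟩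
  have : FiniteDimensional ℂ (ι → ℍ[ℝ]) := FiniteDimensional.right ℝ ℂ _
  let f : (ι → ℍ[ℝ]) →ₗ[ℂ] (ι → ℍ[ℝ]) :=
    { toFun := L
      map_add' := map_add L
      map_smul' := fun z w => by
        have hz : ∀ u : ι → ℍ[ℝ], z • u = z.re • u + z.im • fun i => (Complex.I : ℍ[ℝ]) * u i := by
          intro u
          funext i
          have : (z : ℍ[ℝ]) = z.re • 1 + z.im • (Complex.I : ℍ[ℝ]) := by
            ext <;> simp
          simp only [hsmul, this, Pi.add_apply, Pi.smul_apply, add_mul, smul_mul_assoc, one_mul]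
        rw [RingHom.id_apply, hz, hz, map_add, map_smul, map_smul]
        congr 2
        funext c
        exact hI w c }
  exact LinearMap.det_pos_of_complex f hL

theorem eq_zero_of_sum_pow_smul_eq_zero {C : Type*} {T : C → ℝ} (hT : Function.Injective T)
    {n : ℕ} (p : Fin n → ℍ[ℝ]) (S : Finset C) (hS : n ≤ S.card)
    (h : ∀ c ∈ S, ∑ i : Fin n, T c ^ i.val • p i = 0) : p = 0 := by
  have key : ∀ g : ℍ[ℝ] →ₗ[ℝ] ℝ, ∀ i, g (p i) = 0 := by
    intro g
    let P : Polynomial ℝ := ∑ i : Fin n, Polynomial.monomial i.val (g (p i))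
    have hP : P = 0 := by
      refine Polynomial.eq_zero_of_degree_lt_of_eval_finset_eq_zero (S.map ⟨T, hT⟩) ?_ ?_
      · refine (Polynomial.degree_sum_le _ _).trans_lt ?_
        rw [Finset.sup_lt_iff (by simp)]
        intro i _
        refine (Polynomial.degree_monomial_le _ _).trans_lt ?_
        rw [Finset.card_map]
        exact_mod_cast i.2.trans_le hS
      · intro x hx
        obtain ⟨c, hc, rfl⟩ := Finset.mem_map.1 hx
        have := congrArg g (h c hc)
        simpa [P, Polynomial.eval_finsetSum, mul_comm] using this
    intro i
    have := congrArg (fun Q => Polynomial.coeff Q i.val) hP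
    simpa [P, Polynomial.finsetSum_coeff, Polynomial.coeff_monomial, Fin.val_inj] using this
  funext i
  ext
  · exact key (QuaternionAlgebra.reₗ _ _ _) i
  · exact key (QuaternionAlgebra.imIₗ _ _ _) i
  · exact key (QuaternionAlgebra.imJₗ _ _ _) i
  · exact key (QuaternionAlgebra.imKₗ _ _ _) i

/-- The value at the node `T c` of the polynomial with coefficient vector `p`. -/
noncomputable def nodeEval {C : Type*} {n : ℕ} (T : C → ℝ) (p : Fin n → ℍ[ℝ]) (c : C) : ℍ[ℝ] :=
  ∑ i : Fin n, T c ^ i.val • p i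

theorem nodeEval_succ {C : Type*} {n : ℕ} (T : C → ℝ) (p : Fin (n + 1) → ℍ[ℝ]) (c : C) :
    nodeEval T p c = nodeEval T (fun i : Fin n => p i.castSucc) c + T c ^ n • p (Fin.last n) := by
  simp [nodeEval, Fin.sum_univ_castSucc]

open Classical in
/-- The set of nodes at which a polynomial vanishes. -/
noncomputable def nodeZeros {C : Type*} [Fintype C] {n : ℕ} (T : C → ℝ) (p : Fin n → ℍ[ℝ]) :
    Finset C := {c | nodeEval T p c = 0}

theorem mem_nodeZeros {C : Type*} [Fintype C] {n : ℕ} {T : C → ℝ} {p : Fin n → ℍ[ℝ]} {c : C} :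
    c ∈ nodeZeros T p ↔ nodeEval T p c = 0 := by simp [nodeZeros]

theorem card_nodeZeros_le {C : Type*} [Fintype C] {n : ℕ} {T : C → ℝ}
    (hT : Function.Injective T) {p : Fin (n + 1) → ℍ[ℝ]} (hp : p ≠ 0) :
    (nodeZeros T p).card ≤ n := by
  by_contra! h
  exact hp (eq_zero_of_sum_pow_smul_eq_zero hT p _ h fun c hc => mem_nodeZeros.1 hc)

theorem card_nodeZeros_lt {C : Type*} [Fintype C] {n : ℕ} {T : C → ℝ}
    (hT : Function.Injective T) {p : Fin (n + 1) → ℍ[ℝ]} (hp : p ≠ 0) (h0 : p (Fin.last n) = 0) :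
    (nodeZeros T p).card < n := by
  by_contra! h
  have := eq_zero_of_sum_pow_smul_eq_zero hT (fun i : Fin n => p i.castSucc) (nodeZeros T p) h
    fun c hc => by
      have := mem_nodeZeros.1 hc
      rw [nodeEval_succ, h0, smul_zero, add_zero] at this
      exact this
  refine hp (funext fun i => ?_)
  induction i using Fin.lastCases with
  | last => exact h0
  | cast i => exact congrFun this i

/-- The values at the nodes of the product of two polynomials. -/
noncomputable def nodeMul {C : Type*} {a b : ℕ} (T : C → ℝ) (x : Fin a → ℍ[ℝ]) (v : Fin b → ℍ[ℝ]) :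
    C → ℍ[ℝ] := fun c => nodeEval T v c * nodeEval T x c

theorem univ_subset_of_nodeMul_eq_zero {C : Type*} [Fintype C] [DecidableEq C] {a b : ℕ}
    {T : C → ℝ} {x : Fin a → ℍ[ℝ]} {v : Fin b → ℍ[ℝ]} (h : nodeMul T x v = 0) :
    Finset.univ ⊆ nodeZeros T x ∪ nodeZeros T v := by
  intro c _
  rw [Finset.mem_union, mem_nodeZeros, mem_nodeZeros]
  exact (mul_eq_zero.1 (congrFun h c)).symm

theorem card_nodeZeros_of_nodeMul_eq_zero {C : Type*} [Fintype C] {a b : ℕ}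
    (hC : Fintype.card C = a + b) {T : C → ℝ} (hT : Function.Injective T)
    {x : Fin (a + 1) → ℍ[ℝ]} {v : Fin (b + 1) → ℍ[ℝ]} (hx : x ≠ 0) (hv : v ≠ 0)
    (h : nodeMul T x v = 0) :
    (nodeZeros T x).card = a ∧ (nodeZeros T v).card = b ∧
      Disjoint (nodeZeros T x) (nodeZeros T v) := by
  classical
  have h1 := Finset.card_le_card (univ_subset_of_nodeMul_eq_zero h)
  have h2 := Finset.card_union_add_card_inter (nodeZeros T x) (nodeZeros T v)
  have h3 := card_nodeZeros_le hT hx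
  have h4 := card_nodeZeros_le hT hv
  rw [Finset.card_univ, hC] at h1
  refine ⟨by omega, by omega, ?_⟩
  rw [Finset.disjoint_iff_inter_eq_empty, ← Finset.card_eq_zero]
  omega

theorem last_ne_zero_of_nodeMul_eq_zero {C : Type*} [Fintype C] {a b : ℕ}
    (hC : Fintype.card C = a + b) {T : C → ℝ} (hT : Function.Injective T)
    {x : Fin (a + 1) → ℍ[ℝ]} {v : Fin (b + 1) → ℍ[ℝ]} (hx : x ≠ 0) (hv : v ≠ 0)
    (h : nodeMul T x v = 0) : x (Fin.last a) ≠ 0 ∧ v (Fin.last b) ≠ 0 := by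
  obtain ⟨h1, h2, -⟩ := card_nodeZeros_of_nodeMul_eq_zero hC hT hx hv h
  exact ⟨fun h0 => (card_nodeZeros_lt hT hx h0).ne h1, fun h0 => (card_nodeZeros_lt hT hv h0).ne h2⟩

/-- The monic coefficient vector whose lower coefficients are `p`. -/
def monicVec {n : ℕ} (p : Fin n → ℍ[ℝ]) : Fin (n + 1) → ℍ[ℝ] := Fin.snoc (α := fun _ => ℍ[ℝ]) p 1

theorem monicVec_last {n : ℕ} (p : Fin n → ℍ[ℝ]) : monicVec p (Fin.last n) = 1 := by
  simp [monicVec]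

theorem monicVec_castSucc {n : ℕ} (p : Fin n → ℍ[ℝ]) (i : Fin n) :
    monicVec p i.castSucc = p i := by
  simp [monicVec]

theorem monicVec_ne_zero {n : ℕ} (p : Fin n → ℍ[ℝ]) : monicVec p ≠ 0 := fun h => by
  have := congrFun h (Fin.last n)
  simp [monicVec_last] at this

theorem nodeEval_monicVec {C : Type*} {n : ℕ} (T : C → ℝ) (p : Fin n → ℍ[ℝ]) (c : C) :
    nodeEval T (monicVec p) c = nodeEval T p c + T c ^ n • (1 : ℍ[ℝ]) := by
  rw [nodeEval_succ, monicVec_last]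
  simp_rw [monicVec_castSucc]

theorem exists_nodeEval_monicVec_eq_zero {C : Type*} {n : ℕ} (T : C → ℝ) (g : Fin n → C) :
    ∃ p : Fin n → ℍ[ℝ], ∀ i, nodeEval T (monicVec p) (g i) = 0 := by
  let P : Polynomial ℝ := ∏ i, (Polynomial.X - Polynomial.C (T (g i)))
  have hm : P.Monic := Polynomial.monic_prod_of_monic _ _ fun i _ => Polynomial.monic_X_sub_C _
  have hn : P.natDegree = n := by
    simp [P, Polynomial.natDegree_prod_of_monic _ (fun i => Polynomial.X - Polynomial.C (T (g i)))
      fun i _ => Polynomial.monic_X_sub_C _]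
  refine ⟨fun i => P.coeff i.val • (1 : ℍ[ℝ]), fun i => ?_⟩
  have h0 : P.eval (T (g i)) = 0 := by
    simp only [P, Polynomial.eval_prod]
    exact Finset.prod_eq_zero (Finset.mem_univ i) (by simp)
  rw [Polynomial.eval_eq_sum_range, hn, Finset.sum_range_succ, ← hn, hm.coeff_natDegree, hn,
    Finset.sum_range, one_mul] at h0
  rw [nodeEval_monicVec, nodeEval]
  simp_rw [smul_smul]
  rw [← Finset.sum_smul, ← add_smul]
  simp_rw [mul_comm (T (g i) ^ _)]
  rw [h0, zero_smul]

theorem exists_nodeMul_monicVec_eq_zero {a b : ℕ} (T : Fin a ⊕ Fin b → ℝ) :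
    ∃ y : Fin a ⊕ Fin b → ℍ[ℝ], nodeMul T (monicVec fun i => y (.inl i))
      (monicVec fun i => y (.inr i)) = 0 := by
  obtain ⟨p, hp⟩ := exists_nodeEval_monicVec_eq_zero T (Sum.inl : Fin a → Fin a ⊕ Fin b)
  obtain ⟨q, hq⟩ := exists_nodeEval_monicVec_eq_zero T (Sum.inr : Fin b → Fin a ⊕ Fin b)
  refine ⟨Sum.elim p q, funext fun c => ?_⟩
  rcases c with i | i
  · exact mul_eq_zero_of_right _ (hp i)
  · exact mul_eq_zero_of_left (hq i) _

theorem nodeEval_mul_left {C : Type*} {n : ℕ} (T : C → ℝ) (q : ℍ[ℝ]) (p : Fin n → ℍ[ℝ]) (c : C) :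
    nodeEval T (fun i => q * p i) c = q * nodeEval T p c := by
  simp [nodeEval, Finset.mul_sum]

theorem nodeEval_mul_right {C : Type*} {n : ℕ} (T : C → ℝ) (q : ℍ[ℝ]) (p : Fin n → ℍ[ℝ]) (c : C) :
    nodeEval T (fun i => p i * q) c = nodeEval T p c * q := by
  simp [nodeEval, Finset.sum_mul]

theorem nodeEval_sub {C : Type*} {n : ℕ} (T : C → ℝ) (p q : Fin n → ℍ[ℝ]) (c : C) :
    nodeEval T (fun i => p i - q i) c = nodeEval T p c - nodeEval T q c := by
  simp [nodeEval, smul_sub]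

/-- A monic polynomial vanishing at as many real nodes as its degree has central values. -/
theorem commute_nodeEval_monicVec {C : Type*} [Fintype C] {n : ℕ} {T : C → ℝ}
    (hT : Function.Injective T) {p : Fin n → ℍ[ℝ]} (hp : n ≤ (nodeZeros T (monicVec p)).card)
    (q : ℍ[ℝ]) (c : C) : q * nodeEval T (monicVec p) c = nodeEval T (monicVec p) c * q := by
  have h : (fun i => q * p i - p i * q) = 0 := by
    refine eq_zero_of_sum_pow_smul_eq_zero hT _ _ hp fun c hc => ?_
    have h0 := mem_nodeZeros.1 hc
    rw [nodeEval_monicVec, add_eq_zero_iff_eq_neg] at h0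
    change nodeEval T (fun i => q * p i - p i * q) c = 0
    rw [nodeEval_sub, nodeEval_mul_left, nodeEval_mul_right, h0]
    simp
  have h1 : nodeEval T (fun i => q * p i - p i * q) c = 0 := by
    rw [h]; simp [nodeEval]
  rw [nodeEval_sub, nodeEval_mul_left, nodeEval_mul_right, sub_eq_zero] at h1
  rw [nodeEval_monicVec, mul_add, add_mul, h1]
  simp

/-- Evaluation at a node of the part of the coefficients selected by `s`, as a linear map. -/
noncomputable def nodeEvalCLM {C ι : Type*} [Fintype ι] {n : ℕ} (T : C → ℝ) (s : Fin n → ι)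
    (c : C) : (ι → ℍ[ℝ]) →L[ℝ] ℍ[ℝ] :=
  ∑ i : Fin n, T c ^ i.val • ContinuousLinearMap.proj (R := ℝ) (φ := fun _ : ι => ℍ[ℝ]) (s i)

theorem nodeEvalCLM_apply {C ι : Type*} [Fintype ι] {n : ℕ} (T : C → ℝ) (s : Fin n → ι)
    (c : C) (y : ι → ℍ[ℝ]) : nodeEvalCLM T s c y = nodeEval T (fun i => y (s i)) c := by
  simp [nodeEvalCLM, nodeEval]

theorem det_fderiv_nodeMul_pos {a b : ℕ} {T : Fin a ⊕ Fin b → ℝ} (hT : Function.Injective T)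
    {y : Fin a ⊕ Fin b → ℍ[ℝ]}
    (hy : nodeMul T (monicVec fun i => y (.inl i)) (monicVec fun i => y (.inr i)) = 0) :
    0 < (fderiv ℝ (fun y : Fin a ⊕ Fin b → ℍ[ℝ] => nodeMul T (monicVec fun i => y (.inl i))
      (monicVec fun i => y (.inr i))) y).det := by
  set P : Fin a ⊕ Fin b → ℍ[ℝ] := nodeEval T (monicVec fun i => y (.inl i)) with hP
  set Q : Fin a ⊕ Fin b → ℍ[ℝ] := nodeEval T (monicVec fun i => y (.inr i)) with hQ
  have hfd : ∀ z c, fderiv ℝ (fun y : Fin a ⊕ Fin b → ℍ[ℝ] =>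
      nodeMul T (monicVec fun i => y (.inl i)) (monicVec fun i => y (.inr i))) y z c =
      Q c * nodeEval T (fun i => z (.inl i)) c + nodeEval T (fun i => z (.inr i)) c * P c := by
    intro z c
    have hl : ∀ c, HasFDerivAt (fun y : Fin a ⊕ Fin b → ℍ[ℝ] =>
        nodeEval T (monicVec fun i => y (.inl i)) c) (nodeEvalCLM T Sum.inl c) y := by
      intro c
      simp_rw [nodeEval_monicVec, ← nodeEvalCLM_apply T (Sum.inl : Fin a → Fin a ⊕ Fin b)]
      exact (ContinuousLinearMap.hasFDerivAt _).add_const _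
    have hr : ∀ c, HasFDerivAt (fun y : Fin a ⊕ Fin b → ℍ[ℝ] =>
        nodeEval T (monicVec fun i => y (.inr i)) c) (nodeEvalCLM T Sum.inr c) y := by
      intro c
      simp_rw [nodeEval_monicVec, ← nodeEvalCLM_apply T (Sum.inr : Fin b → Fin a ⊕ Fin b)]
      exact (ContinuousLinearMap.hasFDerivAt _).add_const _
    have h : HasFDerivAt (fun y : Fin a ⊕ Fin b → ℍ[ℝ] =>
        nodeMul T (monicVec fun i => y (.inl i)) (monicVec fun i => y (.inr i))) _ y :=
      hasFDerivAt_pi.2 fun c => (hr c).mul' (hl c)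
    rw [h.fderiv]
    simp [nodeEvalCLM_apply, hP, hQ]
  obtain ⟨h1, h2, h3⟩ := card_nodeZeros_of_nodeMul_eq_zero (by simp) hT (monicVec_ne_zero _)
    (monicVec_ne_zero _) hy
  have hPQ : ∀ c, Q c * P c = 0 := fun c => congrFun hy c
  have hPQ0 : ∀ c, P c = 0 → Q c ≠ 0 := fun c hc hc' =>
    Finset.disjoint_left.1 h3 (mem_nodeZeros.2 hc) (mem_nodeZeros.2 hc')
  refine det_pos_of_comm_imI _ ?_ ?_
  · rw [injective_iff_map_eq_zero]
    intro z hz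
    have hz' := fun c => (hfd z c).symm.trans (congrFun hz c)
    have hl : (fun i => z (.inl i)) = 0 := by
      refine eq_zero_of_sum_pow_smul_eq_zero hT _ _ h1.ge fun c hc => ?_
      have hPc : P c = 0 := mem_nodeZeros.1 hc
      have := hz' c
      rw [hPc, mul_zero, add_zero] at this
      exact (mul_eq_zero.1 this).resolve_left (hPQ0 c hPc)
    have hr : (fun i => z (.inr i)) = 0 := by
      refine eq_zero_of_sum_pow_smul_eq_zero hT _ _ h2.ge fun c hc => ?_
      have hQc : Q c = 0 := mem_nodeZeros.1 hc
      have := hz' c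
      rw [hQc, zero_mul, zero_add] at this
      exact (mul_eq_zero.1 this).resolve_right fun hPc => hPQ0 c hPc hQc
    funext c
    rcases c with i | i
    · exact congrFun hl i
    · exact congrFun hr i
  · intro z c
    rw [hfd, hfd, nodeEval_mul_left, nodeEval_mul_left, mul_add, ← mul_assoc, ← mul_assoc,
      ← mul_assoc, hQ, commute_nodeEval_monicVec hT h2.ge]

theorem contDiff_nodeMul {C : Type*} [Fintype C] {a b : ℕ} (T : C → ℝ) {k : WithTop ℕ∞} :
    ContDiff ℝ k (fun p : (Fin a → ℍ[ℝ]) × (Fin b → ℍ[ℝ]) => nodeMul T p.1 p.2) := by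
  unfold nodeMul nodeEval
  fun_prop

theorem nodeMul_smul_smul {C : Type*} {a b : ℕ} (T : C → ℝ) (r s : ℝ) (x : Fin a → ℍ[ℝ])
    (v : Fin b → ℍ[ℝ]) : nodeMul T (r • x) (s • v) = (r * s) • nodeMul T x v := by
  have h : ∀ {n : ℕ} (r : ℝ) (p : Fin n → ℍ[ℝ]) (c : C),
      nodeEval T (r • p) c = r • nodeEval T p c := fun r p c => by
    simp only [nodeEval, Finset.smul_sum, Pi.smul_apply]
    exact Finset.sum_congr rfl fun i _ => smul_comm _ _ _
  funext c
  simp only [nodeMul, h, smul_mul_smul_comm, Pi.smul_apply, mul_comm s]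

theorem contDiff_monicVec {n : ℕ} {k : WithTop ℕ∞} :
    ContDiff ℝ k (monicVec : (Fin n → ℍ[ℝ]) → Fin (n + 1) → ℍ[ℝ]) := by
  rw [contDiff_pi]
  intro i
  induction i using Fin.lastCases with
  | last => simp_rw [monicVec_last]; exact contDiff_const
  | cast i => simp_rw [monicVec_castSucc]; exact contDiff_apply ..

theorem one_le_norm_monicVec {n : ℕ} (p : Fin n → ℍ[ℝ]) : 1 ≤ ‖monicVec p‖ := by
  have := norm_le_pi_norm (monicVec p) (Fin.last n)
  rwa [monicVec_last, norm_one] at this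

theorem norm_apply_le_norm_monicVec {n : ℕ} (p : Fin n → ℍ[ℝ]) (i : Fin n) :
    ‖p i‖ ≤ ‖monicVec p‖ := by
  have := norm_le_pi_norm (monicVec p) i.castSucc
  rwa [monicVec_castSucc] at this

theorem norm_inv_smul_mem_sphere {V : Type*} [NormedAddCommGroup V] [NormedSpace ℝ V] {x : V}
    (hx : x ≠ 0) : ‖x‖⁻¹ • x ∈ Metric.sphere (0 : V) 1 := by
  rw [mem_sphere_zero_iff_norm, norm_smul, norm_inv, norm_norm,
    inv_mul_cancel₀ (norm_ne_zero_iff.2 hx)]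

/-- A family which is homogeneous in two nonzero variables and does not vanish cannot be
homotoped to the product of polynomials without zeros at infinity. -/
theorem false_of_add_smul_nodeMul_ne_zero {a b : ℕ} {T : Fin a ⊕ Fin b → ℝ}
    (hT : Function.Injective T)
    (G : (Fin (a + 1) → ℍ[ℝ]) → (Fin (b + 1) → ℍ[ℝ]) → Fin a ⊕ Fin b → ℍ[ℝ])
    (hG : ∀ x v, x ≠ 0 → ContDiffAt ℝ 2
      (fun p : (Fin (a + 1) → ℍ[ℝ]) × (Fin (b + 1) → ℍ[ℝ]) => G p.1 p.2) (x, v))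
    (hsmul : ∀ r s : ℝ, 0 < r → 0 < s → ∀ x v, G (r • x) (s • v) = (r * s) • G x v)
    (hne : ∀ x v, x ≠ 0 → v ≠ 0 → G x v ≠ 0)
    (hinf : ∀ (s : ℝ) x v, x ≠ 0 → v ≠ 0 → x (Fin.last a) = 0 ∨ v (Fin.last b) = 0 →
      G x v + s • nodeMul T x v ≠ 0) : False := by
  let F : ℝ × (Fin (a + 1) → ℍ[ℝ]) × (Fin (b + 1) → ℍ[ℝ]) → Fin a ⊕ Fin b → ℍ[ℝ] :=
    fun p => (1 - p.1) • G p.2.1 p.2.2 + p.1 • nodeMul T p.2.1 p.2.2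
  have hF : ∀ t x v, x ≠ 0 → ContDiffAt ℝ 2 F (t, x, v) := by
    intro t x v hx
    have h1 : ContDiffAt ℝ 2 (fun p : ℝ × (Fin (a + 1) → ℍ[ℝ]) × (Fin (b + 1) → ℍ[ℝ]) =>
        G p.2.1 p.2.2) (t, x, v) := by
      have := hG x v hx
      exact ContDiffAt.comp (t, x, v) (g := fun p : (Fin (a + 1) → ℍ[ℝ]) × (Fin (b + 1) → ℍ[ℝ]) =>
        G p.1 p.2) (f := Prod.snd) this contDiffAt_snd
    have h2 : ContDiffAt ℝ 2 (fun p : ℝ × (Fin (a + 1) → ℍ[ℝ]) × (Fin (b + 1) → ℍ[ℝ]) =>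
        nodeMul T p.2.1 p.2.2) (t, x, v) :=
      ((contDiff_nodeMul T).comp contDiff_snd).contDiffAt
    exact ((contDiffAt_const.sub contDiffAt_fst).smul h1).add (contDiffAt_fst.smul h2)
  have hFs : ∀ r s : ℝ, 0 < r → 0 < s → ∀ t x v, F (t, r • x, s • v) = (r * s) • F (t, x, v) := by
    intro r s hr hs t x v
    simp only [F, hsmul r s hr hs, nodeMul_smul_smul, smul_add]
    rw [smul_comm (1 - t), smul_comm t]
  have hpos : ∀ t x v, x ≠ 0 → v ≠ 0 →
      0 < ‖F (t, x, v)‖ + ‖x (Fin.last a)‖ * ‖v (Fin.last b)‖ := by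
    intro t x v hx hv
    by_contra! h
    have h1 : ‖F (t, x, v)‖ = 0 := by
      have := mul_nonneg (norm_nonneg (x (Fin.last a))) (norm_nonneg (v (Fin.last b)))
      have := norm_nonneg (F (t, x, v))
      linarith
    rw [h1, zero_add] at h
    have h2 : x (Fin.last a) = 0 ∨ v (Fin.last b) = 0 := by
      rw [← norm_eq_zero (a := x _), ← norm_eq_zero (a := v _), ← mul_eq_zero]
      exact le_antisymm h (by positivity)
    have h3 : (1 - t) • G x v + t • nodeMul T x v = 0 := norm_eq_zero.1 h1
    by_cases ht : 1 - t = 0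
    · obtain rfl : t = 1 := by linarith
      rw [sub_self, zero_smul, zero_add, one_smul] at h3
      have := last_ne_zero_of_nodeMul_eq_zero (by simp) hT hx hv h3
      tauto
    · refine hinf (t / (1 - t)) x v hx hv h2 ?_
      have := congrArg (fun w => (1 - t)⁻¹ • w) h3
      simpa [smul_smul, ht, div_eq_inv_mul] using this
  obtain ⟨δ, hδ, hle⟩ : ∃ δ > 0, ∀ p ∈ Icc (0 : ℝ) 1 ×ˢ Metric.sphere (0 : Fin (a + 1) → ℍ[ℝ]) 1 ×ˢ
      Metric.sphere (0 : Fin (b + 1) → ℍ[ℝ]) 1,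
      δ ≤ ‖F p‖ + ‖p.2.1 (Fin.last a)‖ * ‖p.2.2 (Fin.last b)‖ := by
    refine (isCompact_Icc.prod ((isCompact_sphere _ _).prod (isCompact_sphere _ _))).exists_forall_le'
      ?_ ?_
    · refine ContinuousOn.add (ContinuousOn.norm ?_) (Continuous.continuousOn (by fun_prop))
      rintro ⟨t, x, v⟩ ⟨-, hx, -⟩
      exact (hF t x v (ne_zero_of_mem_unit_sphere (⟨x, hx⟩ :
        Metric.sphere (0 : Fin (a + 1) → ℍ[ℝ]) 1))).continuousAt.continuousWithinAt
    · rintro ⟨t, x, v⟩ ⟨-, hx, hv⟩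
      exact hpos t x v (ne_zero_of_mem_unit_sphere (⟨x, hx⟩ :
        Metric.sphere (0 : Fin (a + 1) → ℍ[ℝ]) 1)) (ne_zero_of_mem_unit_sphere (⟨v, hv⟩ :
        Metric.sphere (0 : Fin (b + 1) → ℍ[ℝ]) 1))
  have hle' : ∀ t ∈ Icc (0 : ℝ) 1, ∀ x v, x ≠ 0 → v ≠ 0 →
      δ * (‖x‖ * ‖v‖) ≤ ‖F (t, x, v)‖ + ‖x (Fin.last a)‖ * ‖v (Fin.last b)‖ := by
    intro t ht x v hx hv
    have hx' := norm_pos_iff.2 hx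
    have hv' := norm_pos_iff.2 hv
    have := hle (t, ‖x‖⁻¹ • x, ‖v‖⁻¹ • v)
      ⟨ht, norm_inv_smul_mem_sphere hx, norm_inv_smul_mem_sphere hv⟩
    rw [hFs _ _ (inv_pos.2 hx') (inv_pos.2 hv')] at this
    simp only [norm_smul, norm_mul, norm_inv, norm_norm, Pi.smul_apply] at this
    calc δ * (‖x‖ * ‖v‖) ≤ _ := mul_le_mul_of_nonneg_right this (by positivity)
      _ = _ := by field_simp
  let H : ℝ × (Fin a ⊕ Fin b → ℍ[ℝ]) → Fin a ⊕ Fin b → ℍ[ℝ] := fun p =>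
    F (p.1, monicVec fun i => p.2 (.inl i), monicVec fun i => p.2 (.inr i))
  have hH1 : ∀ y, H (1, y) = nodeMul T (monicVec fun i => y (.inl i))
      (monicVec fun i => y (.inr i)) := fun y => by simp [H, F]
  refine not_homotopic_of_det_pos (H := H) (δ := 1) (R := 2 / δ) ?_ one_pos ?_ ?_ ?_ ?_
  · rw [contDiff_iff_contDiffAt]
    rintro ⟨t, y⟩
    refine ContDiffAt.comp (t, y) (g := F) (hF _ _ _ (monicVec_ne_zero _)) ?_
    refine contDiffAt_fst.prodMk (ContDiffAt.prodMk ?_ ?_)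
    · exact (contDiff_monicVec.comp (by fun_prop)).contDiffAt
    · exact (contDiff_monicVec.comp (by fun_prop)).contDiffAt
  · intro t ht y hy
    have h1 := hle' t ht _ _ (monicVec_ne_zero fun i => y (.inl i))
      (monicVec_ne_zero fun i => y (.inr i))
    change ‖F (t, monicVec fun i => y (.inl i), monicVec fun i => y (.inr i))‖ < 1 at hy
    rw [monicVec_last, monicVec_last, norm_one] at h1
    have h2 : ‖monicVec fun i => y (.inl i)‖ * ‖monicVec fun i => y (.inr i)‖ ≤ 2 / δ := by
      rw [le_div_iff₀ hδ]
      linarith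
    have h3 := one_le_norm_monicVec fun i => y (.inl i)
    have h4 := one_le_norm_monicVec fun i => y (.inr i)
    rw [pi_norm_le_iff_of_nonneg (by positivity)]
    rintro (i | i)
    · have := norm_apply_le_norm_monicVec (fun i => y (.inl i)) i
      nlinarith
    · have := norm_apply_le_norm_monicVec (fun i => y (.inr i)) i
      nlinarith
  · intro y
    simpa [H, F] using hne _ _ (monicVec_ne_zero fun i => y (.inl i))
      (monicVec_ne_zero fun i => y (.inr i))
  · simp_rw [hH1]
    exact exists_nodeMul_monicVec_eq_zero T
  · simp_rw [hH1]
    exact fun y hy => det_fderiv_nodeMul_pos hT hy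

/-- The vector with entries `y` below the index `i`, entry `1` at `i` and zeros above. -/
noncomputable def echelonVec {n : ℕ} (i : Fin n) (y : {t // t < i} → ℍ[ℝ]) : Fin n → ℍ[ℝ] := fun t =>
  if h : t < i then y ⟨t, h⟩ else if t = i then 1 else 0

theorem echelonVec_self {n : ℕ} (i : Fin n) (y : {t // t < i} → ℍ[ℝ]) : echelonVec i y i = 1 := by
  simp [echelonVec]

theorem echelonVec_ne_zero {n : ℕ} (i : Fin n) (y : {t // t < i} → ℍ[ℝ]) : echelonVec i y ≠ 0 :=
  fun h => one_ne_zero ((echelonVec_self i y).symm.trans (congrFun h i))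

theorem echelonVec_restrict {n : ℕ} {i : Fin n} {x : Fin n → ℍ[ℝ]} (h1 : x i = 1)
    (h0 : ∀ t, i < t → x t = 0) : echelonVec i (fun t => x t) = x := by
  funext t
  simp only [echelonVec]
  split_ifs with h h'
  · rfl
  · rw [h', h1]
  · exact (h0 t (lt_of_le_of_ne (not_lt.1 h) (Ne.symm h'))).symm

theorem contDiff_echelonVec {n : ℕ} (i : Fin n) {k : WithTop ℕ∞} :
    ContDiff ℝ k (echelonVec i) := by
  rw [contDiff_pi]
  intro t
  simp only [echelonVec]
  split_ifs
  · exact contDiff_apply ..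
  · exact contDiff_const
  · exact contDiff_const

theorem exists_last_ne_zero {n : ℕ} {x : Fin n → ℍ[ℝ]} (hx : x ≠ 0) :
    ∃ i, x i ≠ 0 ∧ ∀ t, i < t → x t = 0 := by
  classical
  obtain ⟨i₀, hi₀⟩ := Function.ne_iff.1 hx
  obtain ⟨i, hi, hmax⟩ := Finset.exists_max_image (Finset.univ.filter fun i => x i ≠ 0) id
    ⟨i₀, by simpa using hi₀⟩
  refine ⟨i, by simpa using hi, fun t ht => ?_⟩
  by_contra h
  exact absurd (hmax t (by simpa using h)) (not_le.2 ht)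

/-- The generic bilinear perturbation with parameters `c`. -/
noncomputable def bilinPert {C : Type*} {a b : ℕ} (c : Fin a × Fin b → C → ℍ[ℝ])
    (x : Fin a → ℍ[ℝ]) (v : Fin b → ℍ[ℝ]) : C → ℍ[ℝ] :=
  fun k => ∑ p, v p.2 * x p.1 * c p k

theorem norm_bilinPert_le {C : Type*} [Fintype C] {a b : ℕ} (c : Fin a × Fin b → C → ℍ[ℝ])
    (x : Fin a → ℍ[ℝ]) (v : Fin b → ℍ[ℝ]) :
    ‖bilinPert c x v‖ ≤ (a * b : ℕ) * ‖c‖ * (‖x‖ * ‖v‖) := by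
  rw [pi_norm_le_iff_of_nonneg (by positivity)]
  intro k
  calc ‖bilinPert c x v k‖ ≤ ∑ p : Fin a × Fin b, ‖v p.2 * x p.1 * c p k‖ := norm_sum_le _ _
    _ ≤ ∑ p : Fin a × Fin b, ‖c‖ * (‖x‖ * ‖v‖) := by
      refine Finset.sum_le_sum fun p _ => ?_
      rw [norm_mul, norm_mul, mul_comm, mul_comm ‖v p.2‖]
      gcongr
      · exact (norm_le_pi_norm (c p) k).trans (norm_le_pi_norm c p)
      · exact norm_le_pi_norm x _
      · exact norm_le_pi_norm v _
    _ = _ := by simp [mul_assoc]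

theorem dimH_iUnion_range_lt {ι W : Type*} [Countable ι] {V : ι → Type*}
    [∀ i, NormedAddCommGroup (V i)] [∀ i, NormedSpace ℝ (V i)] [∀ i, FiniteDimensional ℝ (V i)]
    [NormedAddCommGroup W] [NormedSpace ℝ W] [FiniteDimensional ℝ W] [Nontrivial W]
    {f : ∀ i, V i → W} (hf : ∀ i, ContDiff ℝ 1 (f i))
    (h : ∀ i, finrank ℝ (V i) < finrank ℝ W) : dimH (⋃ i, range (f i)) < finrank ℝ W := by
  rw [dimH_iUnion]
  refine (iSup_le (a := ((finrank ℝ W - 1 : ℕ) : ENNReal)) fun i =>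
    (hf i).dimH_range_le.trans ?_).trans_lt ?_
  · have := h i
    exact_mod_cast (by omega : finrank ℝ (V i) ≤ finrank ℝ W - 1)
  · have : 0 < finrank ℝ W := finrank_pos
    exact_mod_cast (by omega : finrank ℝ W - 1 < finrank ℝ W)

theorem finrank_pi_quaternion (ι : Type*) [Fintype ι] :
    finrank ℝ (ι → ℍ[ℝ]) = Fintype.card ι * 4 := by
  simp [Module.finrank_pi_fintype, Quaternion.finrank_eq_four]

/-- Parametrization of the coefficients `c` for which the perturbed pencil
`G + bilinPert c + s • N` has a zero with last nonzero coordinates `π`. -/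
noncomputable def badCoeff {C : Type*} {a b : ℕ} (G N : (Fin a → ℍ[ℝ]) → (Fin b → ℍ[ℝ]) → C → ℍ[ℝ])
    (π : Fin a × Fin b)
    (w : ℝ × ({t // t < π.1} → ℍ[ℝ]) × ({t // t < π.2} → ℍ[ℝ]) × ({ρ // ρ ≠ π} × C → ℍ[ℝ]))
    (ρ : Fin a × Fin b) (k : C) : ℍ[ℝ] :=
  if h : ρ ≠ π then w.2.2.2 (⟨ρ, h⟩, k) else
    -(G (echelonVec π.1 w.2.1) (echelonVec π.2 w.2.2.1) k +
      w.1 • N (echelonVec π.1 w.2.1) (echelonVec π.2 w.2.2.1) k) -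
    ∑ ρ : {ρ // ρ ≠ π}, echelonVec π.2 w.2.2.1 ρ.1.2 * echelonVec π.1 w.2.1 ρ.1.1 *
      w.2.2.2 (ρ, k)

theorem contDiff_badCoeff {C : Type*} [Fintype C] {a b : ℕ}
    {G N : (Fin a → ℍ[ℝ]) → (Fin b → ℍ[ℝ]) → C → ℍ[ℝ]}
    (hG : ∀ x v, x ≠ 0 → ContDiffAt ℝ 1
      (fun p : (Fin a → ℍ[ℝ]) × (Fin b → ℍ[ℝ]) => G p.1 p.2) (x, v))
    (hN : ContDiff ℝ 1 (fun p : (Fin a → ℍ[ℝ]) × (Fin b → ℍ[ℝ]) => N p.1 p.2))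
    (π : Fin a × Fin b) : ContDiff ℝ 1 (badCoeff G N π) := by
  have hx : ContDiff ℝ 1 fun w : ℝ × ({t // t < π.1} → ℍ[ℝ]) × ({t // t < π.2} → ℍ[ℝ]) ×
      ({ρ // ρ ≠ π} × C → ℍ[ℝ]) => echelonVec π.1 w.2.1 :=
    (contDiff_echelonVec π.1).comp contDiff_snd.fst
  have hv : ContDiff ℝ 1 fun w : ℝ × ({t // t < π.1} → ℍ[ℝ]) × ({t // t < π.2} → ℍ[ℝ]) ×
      ({ρ // ρ ≠ π} × C → ℍ[ℝ]) => echelonVec π.2 w.2.2.1 :=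
    (contDiff_echelonVec π.2).comp contDiff_snd.snd.fst
  have hw : ContDiff ℝ 1 fun w : ℝ × ({t // t < π.1} → ℍ[ℝ]) × ({t // t < π.2} → ℍ[ℝ]) ×
      ({ρ // ρ ≠ π} × C → ℍ[ℝ]) => w.2.2.2 := contDiff_snd.snd.snd
  have hGe : ContDiff ℝ 1 fun w : ℝ × ({t // t < π.1} → ℍ[ℝ]) × ({t // t < π.2} → ℍ[ℝ]) ×
      ({ρ // ρ ≠ π} × C → ℍ[ℝ]) => G (echelonVec π.1 w.2.1) (echelonVec π.2 w.2.2.1) := by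
    rw [contDiff_iff_contDiffAt]
    exact fun w => ContDiffAt.comp w (g := fun p : (Fin a → ℍ[ℝ]) × (Fin b → ℍ[ℝ]) => G p.1 p.2)
      (hG _ _ (echelonVec_ne_zero _ _)) (hx.prodMk hv).contDiffAt
  have hM : ContDiff ℝ 1 fun w : ℝ × ({t // t < π.1} → ℍ[ℝ]) × ({t // t < π.2} → ℍ[ℝ]) ×
      ({ρ // ρ ≠ π} × C → ℍ[ℝ]) => N (echelonVec π.1 w.2.1) (echelonVec π.2 w.2.2.1) :=
    hN.comp (hx.prodMk hv)
  rw [contDiff_pi]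
  intro ρ
  rw [contDiff_pi]
  intro k
  by_cases h : ρ ≠ π
  · simp only [badCoeff, dif_pos h]
    exact contDiff_pi.1 hw _
  · simp only [badCoeff, dif_neg h]
    exact ((contDiff_pi.1 hGe k).add (contDiff_fst.smul (contDiff_pi.1 hM k))).neg.sub
      (ContDiff.sum fun ρ _ => ((contDiff_pi.1 hv _).mul (contDiff_pi.1 hx _)).mul
        (contDiff_pi.1 hw _))

theorem mem_range_badCoeff {C : Type*} {a b : ℕ}
    {G N : (Fin a → ℍ[ℝ]) → (Fin b → ℍ[ℝ]) → C → ℍ[ℝ]} {π : Fin a × Fin b}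
    {c : Fin a × Fin b → C → ℍ[ℝ]} {s : ℝ} {x : Fin a → ℍ[ℝ]} {v : Fin b → ℍ[ℝ]}
    (hx1 : x π.1 = 1) (hx0 : ∀ t, π.1 < t → x t = 0)
    (hv1 : v π.2 = 1) (hv0 : ∀ t, π.2 < t → v t = 0)
    (h : G x v + bilinPert c x v + s • N x v = 0) : c ∈ range (badCoeff G N π) := by
  refine ⟨(s, fun t => x t, fun t => v t, fun ρ => c ρ.1 ρ.2), ?_⟩
  funext ρ k
  by_cases hρ : ρ ≠ π
  · simp only [badCoeff, dif_pos hρ]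
  · simp only [badCoeff, dif_neg hρ, echelonVec_restrict hx1 hx0, echelonVec_restrict hv1 hv0]
    obtain rfl : ρ = π := not_not.1 hρ
    have hk := congrFun h k
    simp only [Pi.add_apply, bilinPert, Pi.smul_apply, Pi.zero_apply,
      Fintype.sum_eq_add_sum_subtype_ne _ ρ, hx1, hv1, one_mul] at hk
    rw [← sub_eq_zero, ← neg_eq_zero, ← hk]
    abel

theorem finrank_badCoeff_lt {C : Type*} [Fintype C] {a b : ℕ} (hC : Fintype.card C = a + b)
    {π : Fin (a + 1) × Fin (b + 1)} (hπ : π.1 ≠ Fin.last a ∨ π.2 ≠ Fin.last b) :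
    finrank ℝ (ℝ × ({t // t < π.1} → ℍ[ℝ]) × ({t // t < π.2} → ℍ[ℝ]) ×
      ({ρ // ρ ≠ π} × C → ℍ[ℝ])) < finrank ℝ (Fin (a + 1) × Fin (b + 1) → C → ℍ[ℝ]) := by
  have h1 : Fintype.card {t // t < π.1} = π.1 := by
    rw [Fintype.card_of_subtype (Finset.Iio π.1) fun t => Finset.mem_Iio, Fin.card_Iio]
  have h2 : Fintype.card {t // t < π.2} = π.2 := by
    rw [Fintype.card_of_subtype (Finset.Iio π.2) fun t => Finset.mem_Iio, Fin.card_Iio]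
  have h3 : Fintype.card {ρ // ρ ≠ π} = (a + 1) * (b + 1) - 1 := by
    simp [Fintype.card_subtype_compl]
  rw [finrank_prod, finrank_prod, finrank_prod, finrank_pi_quaternion, finrank_pi_quaternion,
    finrank_pi_quaternion, h1, h2, Fintype.card_prod, h3, hC, finrank_self,
    finrank_pi_fintype, finrank_pi_quaternion, hC, Finset.sum_const, Finset.card_univ,
    Fintype.card_prod, Fintype.card_fin, Fintype.card_fin, smul_eq_mul]
  obtain ⟨n, hn⟩ : ∃ n, (a + 1) * (b + 1) = n + 1 := ⟨a * b + a + b, by ring⟩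
  have h4 : (π.1 : ℕ) + π.2 < a + b := by
    have := π.1.is_lt
    have := π.2.is_lt
    have : (π.1 : ℕ) ≠ a ∨ (π.2 : ℕ) ≠ b := by
      simpa [Fin.ext_iff] using hπ
    omega
  rw [hn, Nat.add_sub_cancel]
  nlinarith

/-- For generic small parameters the perturbed family does not meet the pencil spanned by the
product of polynomials at infinity. -/
theorem exists_bilinPert_add_smul_ne_zero {C : Type*} [Fintype C] {a b : ℕ}
    (hC : Fintype.card C = a + b)
    {G N : (Fin (a + 1) → ℍ[ℝ]) → (Fin (b + 1) → ℍ[ℝ]) → C → ℍ[ℝ]}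
    (hG : ∀ x v, x ≠ 0 → ContDiffAt ℝ 1
      (fun p : (Fin (a + 1) → ℍ[ℝ]) × (Fin (b + 1) → ℍ[ℝ]) => G p.1 p.2) (x, v))
    (hN : ContDiff ℝ 1 (fun p : (Fin (a + 1) → ℍ[ℝ]) × (Fin (b + 1) → ℍ[ℝ]) => N p.1 p.2))
    (hGe : ∀ p q : ℍ[ℝ], q ≠ 0 → ∀ x v,
      G (fun i => q * x i) (fun i => p * v i * q⁻¹) = fun k => p * G x v k)
    (hNe : ∀ p q : ℍ[ℝ], q ≠ 0 → ∀ x v,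
      N (fun i => q * x i) (fun i => p * v i * q⁻¹) = fun k => p * N x v k)
    {ε : ℝ} (hε : 0 < ε) :
    ∃ c : Fin (a + 1) × Fin (b + 1) → C → ℍ[ℝ], ‖c‖ < ε ∧
      ∀ (s : ℝ) x v, x ≠ 0 → v ≠ 0 → x (Fin.last a) = 0 ∨ v (Fin.last b) = 0 →
      G x v + bilinPert c x v + s • N x v ≠ 0 := by
  by_cases hab : a + b = 0
  · refine ⟨0, by simpa using hε, fun s x v hx hv h => ?_⟩
    obtain ⟨rfl, rfl⟩ : a = 0 ∧ b = 0 := by omega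
    have : ∀ {x : Fin 1 → ℍ[ℝ]}, x (Fin.last 0) = 0 → x = 0 := fun {x} hx => by
      funext i
      rw [Subsingleton.elim i (Fin.last 0), hx]; rfl
    tauto
  have : Nonempty C := Fintype.card_pos_iff.1 (by omega)
  have hdim := dimH_iUnion_range_lt
    (ι := {π : Fin (a + 1) × Fin (b + 1) // π.1 ≠ Fin.last a ∨ π.2 ≠ Fin.last b})
    (f := fun π => badCoeff G N π.1) (fun π => contDiff_badCoeff hG hN π.1)
    (fun π => finrank_badCoeff_lt hC π.2)
  obtain ⟨c, hcball, hc⟩ := (dense_compl_of_dimH_lt_finrank hdim).exists_mem_open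
    Metric.isOpen_ball ⟨0, Metric.mem_ball_self hε⟩
  refine ⟨c, by simpa using hc, fun s x v hx hv hlast h0 => hcball ?_⟩
  obtain ⟨i, hi, hi0⟩ := exists_last_ne_zero hx
  obtain ⟨j, hj, hj0⟩ := exists_last_ne_zero hv
  have hB : ∀ p q : ℍ[ℝ], q ≠ 0 → ∀ x v, bilinPert c (fun i => q * x i)
      (fun i => p * v i * q⁻¹) = fun k => p * bilinPert c x v k := fun p q hq x v => by
    funext k
    simp only [bilinPert, Finset.mul_sum]
    refine Finset.sum_congr rfl fun ρ _ => ?_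
    simp only [mul_assoc, inv_mul_cancel_left₀ hq]
  refine mem_iUnion.2 ⟨⟨(i, j), ?_⟩, mem_range_badCoeff (s := s) (x := fun t => (x i)⁻¹ * x t)
    (v := fun t => (v j * x i)⁻¹ * v t * (x i)⁻¹⁻¹) ?_ ?_ ?_ ?_ ?_⟩
  · rcases hlast with h | h
    · exact .inl fun h' : i = Fin.last a => hi (h' ▸ h)
    · exact .inr fun h' : j = Fin.last b => hj (h' ▸ h)
  · exact inv_mul_cancel₀ hi
  · intro t ht
    simp [hi0 t ht]
  · simp only [inv_inv, mul_assoc]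
    exact inv_mul_cancel₀ (mul_ne_zero hj hi)
  · intro t ht
    simp [hj0 t ht]
  · have hi' := inv_ne_zero hi
    rw [hGe _ _ hi', hNe _ _ hi', hB _ _ hi']
    funext k
    have := congrFun h0 k
    simp only [Pi.add_apply, Pi.smul_apply, Pi.zero_apply] at this ⊢
    rw [← mul_smul_comm, ← mul_add, ← mul_add, this, mul_zero]

theorem nodeMul_equivariant {C : Type*} {a b : ℕ} (T : C → ℝ) (p q : ℍ[ℝ]) (hq : q ≠ 0)
    (x : Fin a → ℍ[ℝ]) (v : Fin b → ℍ[ℝ]) :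
    nodeMul T (fun i => q * x i) (fun i => p * v i * q⁻¹) = fun k => p * nodeMul T x v k := by
  funext k
  simp only [nodeMul, nodeEval_mul_left, nodeEval_mul_right, mul_assoc, inv_mul_cancel_left₀ hq]

/-- There is no smooth equivariant family of injective semilinear maps in this range. -/
theorem false_of_equivariant_ne_zero {a b : ℕ}
    {G : (Fin (a + 1) → ℍ[ℝ]) → (Fin (b + 1) → ℍ[ℝ]) → Fin a ⊕ Fin b → ℍ[ℝ]}
    (hG : ∀ x v, x ≠ 0 → ContDiffAt ℝ 2
      (fun p : (Fin (a + 1) → ℍ[ℝ]) × (Fin (b + 1) → ℍ[ℝ]) => G p.1 p.2) (x, v))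
    (hGe : ∀ p q : ℍ[ℝ], q ≠ 0 → ∀ x v,
      G (fun i => q * x i) (fun i => p * v i * q⁻¹) = fun k => p * G x v k)
    {δ : ℝ} (hδ : 0 < δ) (hne : ∀ x v, x ≠ 0 → δ * (‖x‖ * ‖v‖) ≤ ‖G x v‖) : False := by
  obtain ⟨T, hT⟩ : ∃ T : Fin a ⊕ Fin b → ℝ, Function.Injective T :=
    ⟨fun i => ((finSumFinEquiv i : Fin (a + b)) : ℕ), fun i j h =>
      finSumFinEquiv.injective (Fin.ext (Nat.cast_injective (R := ℝ) h))⟩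
  set n : ℕ := (a + 1) * (b + 1) with hn
  have hn0 : (0 : ℝ) < n := by positivity
  obtain ⟨c, hc, hinf⟩ := exists_bilinPert_add_smul_ne_zero (G := G) (N := nodeMul T) (by simp)
    (fun x v hx => (hG x v hx).of_le (by norm_num)) (contDiff_nodeMul T) hGe
    (nodeMul_equivariant T) (div_pos hδ hn0)
  refine false_of_add_smul_nodeMul_ne_zero hT (fun x v => G x v + bilinPert c x v) ?_ ?_ ?_ hinf
  · intro x v hx
    refine (hG x v hx).add (ContDiff.contDiffAt ?_)
    unfold bilinPert
    fun_prop
  · intro r s hr hs x v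
    have h := hGe ((r * s : ℝ) : ℍ[ℝ]) (r : ℍ[ℝ]) (Quaternion.coe_injective.ne hr.ne') x v
    have h1 : (fun i => (r : ℍ[ℝ]) * x i) = r • x := by
      funext i; simp [Quaternion.coe_mul_eq_smul]
    have h2 : (fun i => ((r * s : ℝ) : ℍ[ℝ]) * v i * (r : ℍ[ℝ])⁻¹) = s • v := by
      funext i
      rw [← Quaternion.coe_inv, Quaternion.mul_coe_eq_smul, Quaternion.coe_mul_eq_smul, smul_smul]
      simp [hr.ne']
    rw [h1, h2] at h
    have h3 : bilinPert c (r • x) (s • v) = (r * s) • bilinPert c x v := by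
      funext k
      simp only [bilinPert, Pi.smul_apply, Finset.smul_sum, smul_mul_assoc, mul_smul_comm, smul_smul]
    rw [h, h3, smul_add]
    congr 1
    funext k
    simp [Quaternion.coe_mul_eq_smul, -Quaternion.coe_mul]
  · intro x v hx hv h0
    have h1 := norm_bilinPert_le c x v
    have h2 := hne x v hx
    rw [eq_neg_of_add_eq_zero_left h0, norm_neg] at h2
    have h3 : 0 < ‖x‖ * ‖v‖ := mul_pos (norm_pos_iff.2 hx) (norm_pos_iff.2 hv)
    rw [lt_div_iff₀ hn0] at hc
    have := h2.trans h1
    rw [← hn] at this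
    have := le_of_mul_le_mul_right this h3
    linarith

theorem Quaternion.star_mul_self_eq_coe_norm_sq (q : ℍ[ℝ]) :
    star q * q = ((‖q‖ ^ 2 : ℝ) : ℍ[ℝ]) := by
  rw [Quaternion.star_mul_self, Quaternion.normSq_eq_norm_mul_self, sq]

theorem Quaternion.self_mul_star_eq_coe_norm_sq (q : ℍ[ℝ]) :
    q * star q = ((‖q‖ ^ 2 : ℝ) : ℍ[ℝ]) := by
  rw [Quaternion.self_mul_star, Quaternion.normSq_eq_norm_mul_self, sq]

/-- The sum of the squared norms of the coordinates. -/
noncomputable def sumNormSq {n : ℕ} (x : Fin n → ℍ[ℝ]) : ℝ := ∑ i, ‖x i‖ ^ 2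

theorem sumNormSq_pos {n : ℕ} {x : Fin n → ℍ[ℝ]} (hx : x ≠ 0) : 0 < sumNormSq x := by
  obtain ⟨i, hi⟩ := Function.ne_iff.1 hx
  exact Finset.sum_pos' (fun _ _ => by positivity)
    ⟨i, Finset.mem_univ i, pow_pos (norm_pos_iff.2 hi) 2⟩

theorem sumNormSq_mul {n : ℕ} (q : ℍ[ℝ]) (x : Fin n → ℍ[ℝ]) :
    sumNormSq (fun i => q * x i) = ‖q‖ ^ 2 * sumNormSq x := by
  simp [sumNormSq, mul_pow, Finset.mul_sum]

theorem contDiff_sumNormSq {n : ℕ} {k : WithTop ℕ∞} :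
    ContDiff ℝ k (sumNormSq : (Fin n → ℍ[ℝ]) → ℝ) :=
  ContDiff.sum fun i _ => (contDiff_apply ℝ ℍ[ℝ] i).norm_sq ℝ

/-- The vector `x` translated to have real `i`-th coordinate. -/
noncomputable def realCoord {n : ℕ} (x : Fin n → ℍ[ℝ]) (i : Fin n) : Fin n → ℍ[ℝ] :=
  fun t => (sumNormSq x)⁻¹ • (star (x i) * x t)

theorem realCoord_mul {n : ℕ} {q : ℍ[ℝ]} (hq : q ≠ 0) (x : Fin n → ℍ[ℝ]) (i : Fin n) :
    realCoord (fun i => q * x i) i = realCoord x i := by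
  funext t
  have : ‖q‖ ≠ 0 := norm_ne_zero_iff.2 hq
  simp only [realCoord, sumNormSq_mul, star_mul]
  rw [mul_assoc, ← mul_assoc (star q), Quaternion.star_mul_self_eq_coe_norm_sq,
    Quaternion.coe_mul_eq_smul, mul_smul_comm, smul_smul]
  congr 1
  field_simp

theorem contDiffAt_realCoord {n : ℕ} {k : WithTop ℕ∞} {x : Fin n → ℍ[ℝ]} (hx : x ≠ 0)
    (i : Fin n) : ContDiffAt ℝ k (fun x => realCoord x i) x := by
  rw [contDiffAt_pi]
  intro t
  refine ContDiffAt.smul (contDiff_sumNormSq.contDiffAt.inv (sumNormSq_pos hx).ne') ?_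
  have : ContDiff ℝ k fun x : Fin n → ℍ[ℝ] => star (x i) :=
    (starAddEquiv.toAddMonoidHom.toRealLinearMap continuous_star).contDiff.comp
      (contDiff_apply ℝ ℍ[ℝ] i)
  exact (this.mul (contDiff_apply ℝ ℍ[ℝ] t)).contDiffAt

/-- The equivariant average of a map. -/
noncomputable def equivAvg {n b : ℕ} {C : Type*} (Q : (Fin n → ℍ[ℝ]) → Fin b → C → ℍ[ℝ])
    (x : Fin n → ℍ[ℝ]) (k : Fin b) (c : C) : ℍ[ℝ] := ∑ i, x i * Q (realCoord x i) k c

theorem equivAvg_mul {n b : ℕ} {C : Type*} (Q : (Fin n → ℍ[ℝ]) → Fin b → C → ℍ[ℝ]) {q : ℍ[ℝ]}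
    (hq : q ≠ 0) (x : Fin n → ℍ[ℝ]) (k : Fin b) (c : C) :
    equivAvg Q (fun i => q * x i) k c = q * equivAvg Q x k c := by
  simp only [equivAvg, realCoord_mul hq, Finset.mul_sum, mul_assoc]

theorem contDiffAt_equivAvg {n b : ℕ} {C : Type*} [Fintype C]
    {Q : (Fin n → ℍ[ℝ]) → Fin b → C → ℍ[ℝ]} {r : WithTop ℕ∞} (hQ : ContDiff ℝ r Q)
    {x : Fin n → ℍ[ℝ]} (hx : x ≠ 0) (k : Fin b) (c : C) :
    ContDiffAt ℝ r (fun x => equivAvg Q x k c) x := by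
  refine ContDiffAt.sum fun i _ => (contDiff_apply ℝ ℍ[ℝ] i).contDiffAt.mul ?_
  have := contDiff_pi.1 (contDiff_pi.1 hQ k) c
  exact ContDiffAt.comp x (g := fun y => Q y k c) this.contDiffAt (contDiffAt_realCoord hx i)

theorem equivAvg_eq_self {n b : ℕ} {C : Type*} {A : (Fin n → ℍ[ℝ]) → Fin b → C → ℍ[ℝ]}
    (hA : ∀ q x k c, A (fun i => q * x i) k c = q * A x k c) {x : Fin n → ℍ[ℝ]} (hx : x ≠ 0)
    (k : Fin b) (c : C) : equivAvg A x k c = A x k c := by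
  have h : ∀ i, x i * A (realCoord x i) k c = ((sumNormSq x)⁻¹ * ‖x i‖ ^ 2) • A x k c := by
    intro i
    have : realCoord x i = fun t => ((sumNormSq x)⁻¹ • star (x i)) * x t := by
      funext t; rw [realCoord, smul_mul_assoc]
    rw [this, hA, smul_mul_assoc, mul_smul_comm, ← mul_assoc,
      Quaternion.self_mul_star_eq_coe_norm_sq, Quaternion.coe_mul_eq_smul, smul_smul]
  simp only [equivAvg, h]
  rw [← Finset.sum_smul, ← Finset.mul_sum]
  change ((sumNormSq x)⁻¹ * sumNormSq x) • _ = _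
  rw [inv_mul_cancel₀ (sumNormSq_pos hx).ne', one_smul]

theorem norm_equivAvg_sub_le {n b : ℕ} {C : Type*} {A Q : (Fin n → ℍ[ℝ]) → Fin b → C → ℍ[ℝ]}
    (hA : ∀ q x k c, A (fun i => q * x i) k c = q * A x k c) {ε : ℝ}
    (hQ : ∀ x k c, ‖Q x k c - A x k c‖ ≤ ε) {x : Fin n → ℍ[ℝ]} (hx : x ≠ 0)
    (k : Fin b) (c : C) : ‖equivAvg Q x k c - A x k c‖ ≤ n * (‖x‖ * ε) := by
  rw [← equivAvg_eq_self hA hx, equivAvg, equivAvg, ← Finset.sum_sub_distrib]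
  calc _ ≤ ∑ i : Fin n, ‖x i * Q (realCoord x i) k c - x i * A (realCoord x i) k c‖ :=
        norm_sum_le _ _
    _ ≤ ∑ i : Fin n, ‖x‖ * ε := by
      refine Finset.sum_le_sum fun i _ => ?_
      rw [← mul_sub, norm_mul]
      exact mul_le_mul (norm_le_pi_norm x i) (hQ _ k c) (norm_nonneg _) (norm_nonneg _)
    _ = _ := by simp

/-- There is no continuous equivariant family of injective semilinear maps in this range. -/
theorem false_of_continuous_equivariant {a b : ℕ}
    {A : (Fin (a + 1) → ℍ[ℝ]) → Fin (b + 1) → Fin a ⊕ Fin b → ℍ[ℝ]} (hAc : Continuous A)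
    (hA : ∀ q x k c, A (fun i => q * x i) k c = q * A x k c)
    (hinj : ∀ x (v : Fin (b + 1) → ℍ[ℝ]), x ≠ 0 → v ≠ 0 → (fun c => ∑ k, v k * A x k c) ≠ 0) : False := by
  let B : (Fin (a + 1) → ℍ[ℝ]) × (Fin (b + 1) → ℍ[ℝ]) → Fin a ⊕ Fin b → ℍ[ℝ] :=
    fun p c => ∑ k, p.2 k * A p.1 k c
  have hB : Continuous B := by
    have h (k c) : Continuous fun p : (Fin (a + 1) → ℍ[ℝ]) × (Fin (b + 1) → ℍ[ℝ]) => A p.1 k c :=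
      (continuous_pi_iff.1 (continuous_pi_iff.1 hAc k) c).comp continuous_fst
    refine continuous_pi fun c => continuous_finsetSum _ fun k _ => Continuous.mul (by fun_prop)
      (h k c)
  have hBs : ∀ (r s : ℝ) x v, B (r • x, s • v) = (r * s) • B (x, v) := by
    intro r s x v
    have hr : ∀ k c, A (r • x) k c = r • A x k c := fun k c => by
      have := hA r x k c
      simp only [Quaternion.coe_mul_eq_smul] at this
      exact this
    funext c
    simp only [B, hr, Pi.smul_apply, Finset.smul_sum, smul_mul_smul_comm, mul_comm s]
  obtain ⟨δ, hδ, hle⟩ : ∃ δ > 0, ∀ p ∈ Metric.sphere (0 : Fin (a + 1) → ℍ[ℝ]) 1 ×ˢ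
      Metric.sphere (0 : Fin (b + 1) → ℍ[ℝ]) 1, δ ≤ ‖B p‖ := by
    refine ((isCompact_sphere _ _).prod (isCompact_sphere _ _)).exists_forall_le'
      hB.norm.continuousOn ?_
    rintro ⟨x, v⟩ ⟨hx, hv⟩
    exact norm_pos_iff.2 (hinj x v (ne_zero_of_mem_unit_sphere (⟨x, hx⟩ :
        Metric.sphere (0 : Fin (a + 1) → ℍ[ℝ]) 1)) (ne_zero_of_mem_unit_sphere (⟨v, hv⟩ :
        Metric.sphere (0 : Fin (b + 1) → ℍ[ℝ]) 1)))
  have hle' : ∀ x v, x ≠ 0 → δ * (‖x‖ * ‖v‖) ≤ ‖B (x, v)‖ := by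
    intro x v hx
    rcases eq_or_ne v 0 with rfl | hv
    · simp
    have hx' := norm_pos_iff.2 hx
    have hv' := norm_pos_iff.2 hv
    have := hle (‖x‖⁻¹ • x, ‖v‖⁻¹ • v) ⟨norm_inv_smul_mem_sphere hx, norm_inv_smul_mem_sphere hv⟩
    rw [hBs] at this
    simp only [norm_smul, norm_mul, norm_inv, norm_norm] at this
    calc δ * (‖x‖ * ‖v‖) ≤ _ := mul_le_mul_of_nonneg_right this (by positivity)
      _ = _ := by field_simp
  obtain ⟨ε, hε, hεδ⟩ : ∃ ε > 0, ((b + 1 : ℕ) : ℝ) * (((a + 1 : ℕ) : ℝ) * ε) = δ / 2 :=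
    ⟨δ / 2 / ((b + 1 : ℕ) : ℝ) / ((a + 1 : ℕ) : ℝ), by positivity, by field_simp⟩
  obtain ⟨Q, hQ, hQA, -⟩ := hAc.exists_contDiff_approx (ε := fun _ => ε) 2 continuous_const
    fun _ => hε
  have hQA' : ∀ x k c, ‖Q x k c - A x k c‖ ≤ ε := fun x k c => by
    have := (hQA x).le
    rw [dist_eq_norm] at this
    exact ((norm_le_pi_norm ((Q x - A x) k) c).trans (norm_le_pi_norm (Q x - A x) k)).trans this
  refine false_of_equivariant_ne_zero (G := fun x v c => ∑ k, v k * equivAvg Q x k c) ?_ ?_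
    (half_pos hδ) ?_
  · intro x v hx
    rw [contDiffAt_pi]
    intro c
    refine ContDiffAt.sum fun k _ => ContDiffAt.mul ?_ ?_
    · exact ContDiff.contDiffAt (by fun_prop)
    · exact ContDiffAt.comp (x, v) (g := fun y => equivAvg Q y k c) (contDiffAt_equivAvg hQ hx k c)
        contDiffAt_fst
  · intro p q hq x v
    funext c
    simp only [equivAvg_mul Q hq, Finset.mul_sum, mul_assoc, inv_mul_cancel_left₀ hq]
  · intro x v hx
    have h1 : ‖(fun c => ∑ k, v k * equivAvg Q x k c) - B (x, v)‖ ≤ δ / 2 * (‖x‖ * ‖v‖) := by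
      rw [pi_norm_le_iff_of_nonneg (by positivity)]
      intro c
      simp only [B, Pi.sub_apply, ← Finset.sum_sub_distrib, ← mul_sub]
      calc _ ≤ ∑ k : Fin (b + 1), ‖v k * (equivAvg Q x k c - A x k c)‖ := norm_sum_le _ _
        _ ≤ ∑ k : Fin (b + 1), ‖v‖ * ((a + 1 : ℕ) * (‖x‖ * ε)) := by
          refine Finset.sum_le_sum fun k _ => ?_
          rw [norm_mul]
          exact mul_le_mul (norm_le_pi_norm v k) (norm_equivAvg_sub_le hA hQA' hx k c)
            (norm_nonneg _) (norm_nonneg _)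
        _ = _ := by
          rw [← hεδ, Finset.sum_const, Finset.card_univ, Fintype.card_fin, nsmul_eq_mul]
          ring
    have h2 := hle' x v hx
    have h3 := norm_sub_norm_le (B (x, v)) (fun c => ∑ k, v k * equivAvg Q x k c)
    rw [norm_sub_rev] at h3
    linarith

/-- The standard quaternionic hermitian product, linear in the first variable. -/
noncomputable def qInner {n : ℕ} (u w : Fin n → ℍ[ℝ]) : ℍ[ℝ] := ∑ c, u c * star (w c)

theorem qInner_smul_left {n : ℕ} (q : ℍ[ℝ]) (u w : Fin n → ℍ[ℝ]) :
    qInner (q • u) w = q * qInner u w := by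
  simp [qInner, Finset.mul_sum, mul_assoc]

theorem qInner_smul_right {n : ℕ} (q : ℍ[ℝ]) (u w : Fin n → ℍ[ℝ]) :
    qInner u (q • w) = qInner u w * star q := by
  simp [qInner, Finset.sum_mul, mul_assoc]

theorem qInner_sub_left {n : ℕ} (u u' w : Fin n → ℍ[ℝ]) :
    qInner (u - u') w = qInner u w - qInner u' w := by
  simp [qInner, sub_mul]

theorem qInner_sum_left {n : ℕ} {ι : Type*} [Fintype ι] (u : ι → Fin n → ℍ[ℝ])
    (w : Fin n → ℍ[ℝ]) : qInner (∑ i, u i) w = ∑ i, qInner (u i) w := by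
  simp only [qInner, Finset.sum_apply, Finset.sum_mul]
  exact Finset.sum_comm

theorem star_qInner {n : ℕ} (u w : Fin n → ℍ[ℝ]) : star (qInner u w) = qInner w u := by
  simp [qInner]

theorem qInner_self {n : ℕ} (u : Fin n → ℍ[ℝ]) : qInner u u = (sumNormSq u : ℍ[ℝ]) := by
  simp only [qInner, sumNormSq, Quaternion.self_mul_star_eq_coe_norm_sq]
  exact (map_sum (algebraMap ℝ ℍ[ℝ]) _ _).symm

theorem Continuous.qInner {X : Type*} [TopologicalSpace X] {n : ℕ} {u w : X → Fin n → ℍ[ℝ]}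
    (hu : Continuous u) (hw : Continuous w) : Continuous fun x => qInner (u x) (w x) :=
  continuous_finsetSum _ fun c _ => (continuous_pi_iff.1 hu c).mul
    (continuous_pi_iff.1 hw c).star

/-- The component of `t` orthogonal to the rows of `A`. -/
noncomputable def orthComp {n k : ℕ} (A : Fin k → Fin n → ℍ[ℝ]) (t : Fin n → ℍ[ℝ]) :
    Fin n → ℍ[ℝ] := t - ∑ i, qInner t (A i) • A i

theorem qInner_orthComp {n k : ℕ} {A : Fin k → Fin n → ℍ[ℝ]}
    (hA : ∀ i j, qInner (A i) (A j) = if i = j then 1 else 0) (t : Fin n → ℍ[ℝ]) (j : Fin k) :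
    qInner (orthComp A t) (A j) = 0 := by
  simp [orthComp, qInner_sub_left, qInner_sum_left, qInner_smul_left, hA]

theorem orthComp_smul {n k : ℕ} (A : Fin k → Fin n → ℍ[ℝ]) (t : Fin n → ℍ[ℝ]) (q : ℍ[ℝ])
    {u : ℍ[ℝ]} (hu : ‖u‖ = 1) : orthComp (fun i => u • A i) (q • t) = q • orthComp A t := by
  simp only [orthComp, qInner_smul_left, qInner_smul_right, smul_sub, Finset.smul_sum, smul_smul]
  congr 1
  refine Finset.sum_congr rfl fun i _ => ?_
  rw [mul_assoc, mul_assoc, Quaternion.star_mul_self_eq_coe_norm_sq, hu]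
  simp

theorem sumNormSq_smul {n : ℕ} (q : ℍ[ℝ]) (x : Fin n → ℍ[ℝ]) :
    sumNormSq (q • x) = ‖q‖ ^ 2 * sumNormSq x := sumNormSq_mul q x

/-- The normalization of a nonzero vector. -/
noncomputable def qNormalize {n : ℕ} (r : Fin n → ℍ[ℝ]) : Fin n → ℍ[ℝ] :=
  ((√(sumNormSq r))⁻¹ : ℝ) • r

theorem qNormalize_eq_smul {n : ℕ} (r : Fin n → ℍ[ℝ]) :
    qNormalize r = (((√(sumNormSq r))⁻¹ : ℝ) : ℍ[ℝ]) • r := by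
  funext c
  simp [qNormalize, Quaternion.coe_mul_eq_smul, -Quaternion.coe_inv]

theorem qInner_qNormalize_self {n : ℕ} {r : Fin n → ℍ[ℝ]} (hr : r ≠ 0) :
    qInner (qNormalize r) (qNormalize r) = 1 := by
  have h := sumNormSq_pos hr
  rw [qNormalize_eq_smul, qInner_smul_left, qInner_smul_right, qInner_self, Quaternion.star_coe,
    ← Quaternion.coe_mul, ← Quaternion.coe_mul, ← Quaternion.coe_one]
  congr 1
  have h2 : √(sumNormSq r) ≠ 0 := (Real.sqrt_pos.2 h).ne'
  nth_rewrite 2 [← Real.mul_self_sqrt h.le]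
  field_simp

theorem qNormalize_smul {n : ℕ} (q : ℍ[ℝ]) (r : Fin n → ℍ[ℝ]) :
    qNormalize (q • r) = (‖q‖⁻¹ • q) • qNormalize r := by
  rw [qNormalize, qNormalize, sumNormSq_smul, Real.sqrt_mul (by positivity),
    Real.sqrt_sq (norm_nonneg q), mul_inv]
  funext c
  simp [smul_smul, mul_comm]

theorem Continuous.qNormalize {X : Type*} [TopologicalSpace X] {n : ℕ} {r : X → Fin n → ℍ[ℝ]}
    (hr : Continuous r) (h0 : ∀ x, r x ≠ 0) : Continuous fun x => qNormalize (r x) :=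
  ((Real.continuous_sqrt.comp ((contDiff_sumNormSq (k := 0)).continuous.comp hr)).inv₀
    fun x => (Real.sqrt_pos.2 (sumNormSq_pos (h0 x))).ne').smul hr

/-- Equivariant Gram–Schmidt orthonormalization of a continuous family of frames. -/
theorem exists_orthonormal_family {X : Type*} [TopologicalSpace X] {n k : ℕ}
    {T : X → Fin k → Fin n → ℍ[ℝ]} (hT : Continuous T) (hli : ∀ x, LinearIndependent ℍ[ℝ] (T x)) :
    ∃ A : X → Fin k → Fin n → ℍ[ℝ], Continuous A ∧
      (∀ x i j, qInner (A x i) (A x j) = if i = j then 1 else 0) ∧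
      (∀ x i, A x i ∈ Submodule.span ℍ[ℝ] (range (T x))) ∧
      ∀ x y (q : ℍ[ℝ]), q ≠ 0 → (∀ i, T y i = q • T x i) → ∀ i, A y i = (‖q‖⁻¹ • q) • A x i := by
  induction k with
  | zero => exact ⟨T, hT, fun _ i => i.elim0, fun _ i => i.elim0, fun _ _ _ _ _ i => i.elim0⟩
  | succ k ih =>
    have hTi (i) : Continuous fun x => T x i := continuous_pi_iff.1 hT i
    have hli' := fun x => linearIndependent_finSucc'.1 (hli x)
    obtain ⟨A, hA, hAo, hAs, hAe⟩ := ih (T := fun x => Fin.init (T x))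
      (continuous_pi fun i => hTi i.castSucc) fun x => (hli' x).1
    have hr0 : ∀ x, orthComp (A x) (T x (Fin.last k)) ≠ 0 := fun x h0 => by
      refine (hli' x).2 ?_
      rw [sub_eq_zero.1 h0]
      exact Submodule.sum_mem _ fun i _ => Submodule.smul_mem _ _ (hAs x i)
    have hrc : Continuous fun x => orthComp (A x) (T x (Fin.last k)) :=
      (hTi _).sub (continuous_finsetSum _ fun i _ =>
        ((hTi _).qInner (continuous_pi_iff.1 hA i)).smul (continuous_pi_iff.1 hA i))
    have hmono : ∀ x, Submodule.span ℍ[ℝ] (range (Fin.init (T x))) ≤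
        Submodule.span ℍ[ℝ] (range (T x)) := fun x =>
      Submodule.span_mono (range_subset_iff.2 fun i => mem_range_self i.castSucc)
    have hRA : ∀ x j, qInner (qNormalize (orthComp (A x) (T x (Fin.last k)))) (A x j) = 0 :=
      fun x j => by
        rw [qNormalize_eq_smul, qInner_smul_left, qInner_orthComp (hAo x), mul_zero]
    refine ⟨fun x => Fin.snoc (α := fun _ => Fin n → ℍ[ℝ]) (A x)
      (qNormalize (orthComp (A x) (T x (Fin.last k)))), ?_, ?_, ?_, ?_⟩
    · refine continuous_pi fun i => ?_
      induction i using Fin.lastCases with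
      | last => simpa using hrc.qNormalize hr0
      | cast i => simpa using continuous_pi_iff.1 hA i
    · intro x i j
      induction i using Fin.lastCases with
      | last =>
        induction j using Fin.lastCases with
        | last => simpa using qInner_qNormalize_self (hr0 x)
        | cast j => simpa [(Fin.castSucc_lt_last j).ne'] using hRA x j
      | cast i =>
        induction j using Fin.lastCases with
        | last =>
          simp only [Fin.snoc_castSucc, Fin.snoc_last, (Fin.castSucc_lt_last i).ne, if_false]
          rw [← star_qInner, hRA, star_zero]
        | cast j => simpa using hAo x i j
    · intro x i
      induction i using Fin.lastCases with
      | last =>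
        beta_reduce
        rw [Fin.snoc_last, qNormalize_eq_smul]
        exact Submodule.smul_mem _ _ (Submodule.sub_mem _
          (Submodule.subset_span (mem_range_self _))
          (Submodule.sum_mem _ fun i _ => Submodule.smul_mem _ _ (hmono x (hAs x i))))
      | cast i => simpa using hmono x (hAs x i)
    · intro x y q hq h i
      have hAe' := hAe x y q hq fun i => h i.castSucc
      induction i using Fin.lastCases with
      | last =>
        have hu : ‖‖q‖⁻¹ • q‖ = 1 := by
          rw [norm_smul, norm_inv, norm_norm, inv_mul_cancel₀ (norm_ne_zero_iff.2 hq)]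
        beta_reduce
        rw [Fin.snoc_last, Fin.snoc_last, ← qNormalize_smul, h, funext hAe', orthComp_smul _ _ _ hu]
      | cast i => simpa using hAe' i

/-- The rows of the Toeplitz matrix of `x` are the shifts of `x`. -/
noncomputable def toeplitz {a : ℕ} (n k : ℕ) (x : Fin a → ℍ[ℝ]) (i : Fin k) (c : Fin n) : ℍ[ℝ] :=
  if h : (i : ℕ) ≤ c ∧ (c : ℕ) - i < a then x ⟨c - i, h.2⟩ else 0

theorem toeplitz_smul {a n k : ℕ} (q : ℍ[ℝ]) (x : Fin a → ℍ[ℝ]) (i : Fin k) :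
    toeplitz n k (q • x) i = q • toeplitz n k x i := by
  funext c
  simp only [toeplitz, Pi.smul_apply]
  split_ifs <;> simp

theorem continuous_toeplitz {a n k : ℕ} :
    Continuous (toeplitz n k : (Fin a → ℍ[ℝ]) → Fin k → Fin n → ℍ[ℝ]) := by
  refine continuous_pi fun i => continuous_pi fun c => ?_
  simp only [toeplitz]
  split_ifs <;> fun_prop

theorem linearIndependent_toeplitz {a n k : ℕ} (h : a + k ≤ n) {x : Fin (a + 1) → ℍ[ℝ]}
    (hx : x ≠ 0) : LinearIndependent ℍ[ℝ] (toeplitz n k x) := by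
  rw [Fintype.linearIndependent_iff]
  intro u hu
  by_contra! hu0
  obtain ⟨i, hi, hi0⟩ := exists_last_ne_zero (x := u) (Function.ne_iff.2 hu0)
  obtain ⟨j, hj, hj0⟩ := exists_last_ne_zero hx
  have hc := congrFun hu ⟨i + j, by omega⟩
  rw [Finset.sum_apply, Finset.sum_eq_single i] at hc
  · simp [toeplitz, hi, hj] at hc
    omega
  · intro t _ ht
    rcases lt_or_gt_of_ne ht with hlt | hgt
    · rw [Pi.smul_apply, toeplitz]
      split_ifs with h'
      · rw [hj0 _ ?_, smul_zero]
        rw [Fin.lt_def] at hlt ⊢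
        simp only
        omega
      · exact smul_zero _
    · simp [hi0 t hgt]
  · simp

theorem toeplitz_family_exists {n k a : ℕ} (h : a + k ≤ n) :
    ∃ S : {x : Fin (a + 1) → ℍ[ℝ] // x ≠ 0} → QStiefel n k, Continuous S ∧
      ∀ x y (q : ℍ[ℝ]), q ≠ 0 → y.1 = q • x.1 → (S y).1 = (‖q‖⁻¹ • q) • (S x).1 := by
  obtain ⟨A, hA, hAo, -, hAe⟩ := exists_orthonormal_family
    (X := {x : Fin (a + 1) → ℍ[ℝ] // x ≠ 0}) (T := fun x => toeplitz n k x.1)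
    (continuous_toeplitz.comp continuous_subtype_val) fun x => linearIndependent_toeplitz h x.2
  refine ⟨fun x => ⟨Matrix.of (A x), ?_⟩, ?_, ?_⟩
  · ext1 i j
    rw [Matrix.one_apply, ← hAo x i j]
    rfl
  · exact Continuous.subtype_mk hA _
  · intro x y q hq hxy
    ext1 i c
    exact congrFun (hAe x y q hq (fun i => by rw [hxy, toeplitz_smul]) i) c

theorem QStiefel.norm_apply_le_one {n k : ℕ} (A : QStiefel n k) (i : Fin k) (c : Fin n) :
    ‖A.1 i c‖ ≤ 1 := by
  have h : qInner (A.1 i) (A.1 i) = 1 := by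
    have := congrFun (congrFun A.2 i) i
    rwa [Matrix.one_apply_eq] at this
  rw [qInner_self, ← Quaternion.coe_one, Quaternion.coe_inj] at h
  have h1 : ‖A.1 i c‖ ^ 2 ≤ sumNormSq (A.1 i) :=
    Finset.single_le_sum (f := fun c => ‖A.1 i c‖ ^ 2) (fun _ _ => by positivity)
      (Finset.mem_univ c)
  rw [h] at h1
  exact (sq_le_one_iff₀ (norm_nonneg _)).1 h1

theorem QStiefel.eq_zero_of_vecMul_eq_zero {n k : ℕ} (A : QStiefel n k) {v : Fin k → ℍ[ℝ]}
    (h : Matrix.vecMul v A.1 = 0) : v = 0 := by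
  rw [← Matrix.vecMul_one v, ← A.2, ← Matrix.vecMul_vecMul, h, Matrix.zero_vecMul]

theorem false_of_equivariant_to_QStiefel {a b : ℕ}
    {F : {x : Fin (a + 1) → ℍ[ℝ] // x ≠ 0} → QStiefel (a + b) (b + 1)} (hF : Continuous F)
    (hFe : ∀ x y (q : ℍ[ℝ]), q ≠ 0 → y.1 = q • x.1 → (F y).1 = (‖q‖⁻¹ • q) • (F x).1) :
    False := by
  classical
  let A : (Fin (a + 1) → ℍ[ℝ]) → Fin (b + 1) → Fin a ⊕ Fin b → ℍ[ℝ] := fun x k c =>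
    if h : x ≠ 0 then ‖x‖ • (F ⟨x, h⟩).1 k (finSumFinEquiv c) else 0
  have hA1 : ∀ x (h : x ≠ 0) k c, A x k c = ‖x‖ • (F ⟨x, h⟩).1 k (finSumFinEquiv c) :=
    fun x h k c => dif_pos h
  have hA0 : ∀ k c, A 0 k c = 0 := fun k c => dif_neg (not_not.2 rfl)
  refine false_of_continuous_equivariant (A := A) ?_ ?_ ?_
  · refine continuous_pi fun k => continuous_pi fun c => continuous_iff_continuousAt.2 fun x => ?_
    by_cases hx : x = 0
    · subst hx
      have hle : ∀ x, ‖A x k c‖ ≤ ‖x‖ := fun x => by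
        by_cases h : x = 0
        · simp [h, hA0]
        · rw [hA1 x h, norm_smul, norm_norm]
          exact mul_le_of_le_one_right (norm_nonneg x) (QStiefel.norm_apply_le_one _ _ _)
      rw [ContinuousAt, hA0]
      exact squeeze_zero_norm hle tendsto_norm_zero
    · have hopen : IsOpen {x : Fin (a + 1) → ℍ[ℝ] | x ≠ 0} := isOpen_ne
      refine ContinuousOn.continuousAt (s := {x : Fin (a + 1) → ℍ[ℝ] | x ≠ 0}) ?_
        (hopen.mem_nhds hx)
      rw [continuousOn_iff_continuous_domRestrict]
      have h1 : Continuous fun y : {x : Fin (a + 1) → ℍ[ℝ] // x ≠ 0} =>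
          ‖y.1‖ • (F y).1 k (finSumFinEquiv c) :=
        continuous_subtype_val.norm.smul ((continuous_subtype_val.comp hF).matrix_elem _ _)
      exact h1.congr fun y => (hA1 y.1 y.2 k c).symm
  · intro q x k c
    change A (q • x) k c = _
    by_cases hx : x = 0
    · simp [hx, hA0]
    by_cases hq : q = 0
    · simp [hq, hA0]
    rw [hA1 x hx, hA1 _ (smul_ne_zero hq hx), hFe ⟨x, hx⟩ ⟨q • x, smul_ne_zero hq hx⟩ q hq rfl,
      norm_smul, Matrix.smul_apply, smul_eq_mul, smul_mul_assoc, smul_smul, mul_smul_comm]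
    congr 1
    have : ‖q‖ ≠ 0 := norm_ne_zero_iff.2 hq
    field_simp
  · intro x v hx hv h0
    refine hv ((F ⟨x, hx⟩).eq_zero_of_vecMul_eq_zero (funext fun c => ?_))
    have h := congrFun h0 (finSumFinEquiv.symm c)
    simp only [hA1 x hx, Equiv.apply_symm_apply, mul_smul_comm, ← Finset.smul_sum] at h
    exact (smul_eq_zero.1 h).resolve_left (norm_ne_zero_iff.2 hx)

end

/-- If there exists an `S³`-equivariant continuous map `ℍV_{n,k} → ℍV_{m,l}`
(equivariant for entrywise left multiplication by unit quaternions), then `n - k ≤ m - l`. -/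
theorem stmt0 (n k m l : ℕ) (hk : 1 ≤ k) (hkn : k ≤ n) (hl : 1 ≤ l) (hlm : l ≤ m)
    (f : QStiefel n k → QStiefel m l) (hf : Continuous f)
    (heq : ∀ (q : ℍ[ℝ]), ‖q‖ = 1 → ∀ (A : QStiefel n k)
      (h : (q • A.1) * (q • A.1)ᴴ = 1),
      (f ⟨q • A.1, h⟩).1 = q • (f A).1) :
    n - k ≤ m - l := by
  by_contra! hlt
  obtain ⟨b, rfl⟩ : ∃ b, l = b + 1 := ⟨l - 1, by omega⟩
  obtain ⟨a, rfl⟩ : ∃ a, m = a + b := ⟨m - b, by omega⟩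
  obtain ⟨S, hS, hSe⟩ := toeplitz_family_exists (a := a) (k := k) (n := n) (by omega)
  refine false_of_equivariant_to_QStiefel (hf.comp hS) fun x y q hq hxy => ?_
  have hu : ‖‖q‖⁻¹ • q‖ = 1 := by
    rw [norm_smul, norm_inv, norm_norm, inv_mul_cancel₀ (norm_ne_zero_iff.2 hq)]
  have h := hSe x y q hq hxy
  have hmem : ((‖q‖⁻¹ • q) • (S x).1) * ((‖q‖⁻¹ • q) • (S x).1)ᴴ = 1 := h ▸ (S y).2
  have hy : S y = ⟨(‖q‖⁻¹ • q) • (S x).1, hmem⟩ := Subtype.ext h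
  rw [Function.comp_apply, Function.comp_apply, hy, heq _ hu]
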